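/- arXiv:1502.00693 — 3 statements merged into one kernel-verified Lean document; each statement's English description precedes it below -/
import Mathlib

section
/- The space of unlabeled typical 6-configurations in the real projective plane has exactly 4 path components; equivalently, typical 6-configurations of points in ℙ²(ℝ) split into exactly 4 Q-deformation classes. -/
open scoped LinearAlgebra.Projectivization
open Projectivization

noncomputable section

/-- The real projective plane: the projectivization of `ℝ³`. -/
abbrev RP2 := ℙ ℝ (Fin 3 → ℝ)

/-- The quotient topology on the real projective plane. -/
instance : TopologicalSpace RP2 :=
  inferInstanceAs (TopologicalSpace (Quotient (projectivizationSetoid ℝ (Fin 3 → ℝ))))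

/-- Three points of `ℙ²(ℝ)` are collinear if they admit linearly dependent representatives. -/
def Collin (a b c : RP2) : Prop :=
  ¬ LinearIndependent ℝ ![a.rep, b.rep, c.rep]

/-- The conic (zero set in `ℙ²(ℝ)`) associated to a quadratic form on `ℝ³`. -/
def ConicSet (q : QuadraticForm ℝ (Fin 3 → ℝ)) : Set RP2 := {p : RP2 | q p.rep = 0}

/-- A set of points is coconic if some conic contains all of them. -/
def Coconic (s : Set RP2) : Prop :=
  ∃ q : QuadraticForm ℝ (Fin 3 → ℝ), q ≠ 0 ∧ ∀ p ∈ s, q p.rep = 0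

/-- A labeled `n`-configuration is simple if it is injective and has no collinear triple. -/
def SimpleCfg {n : ℕ} (f : Fin n → RP2) : Prop :=
  Function.Injective f ∧
    ∀ i j k : Fin n, i ≠ j → i ≠ k → j ≠ k → ¬ Collin (f i) (f j) (f k)

/-- A labeled `n`-configuration is typical if it is simple and no six of its points are coconic. -/
def TypicalCfg {n : ℕ} (f : Fin n → RP2) : Prop :=
  SimpleCfg f ∧ ∀ g : Fin 6 → Fin n, Function.Injective g → ¬ Coconic (Set.range (f ∘ g))

/-- A projective line: the set of points whose representatives lie in a 2-dimensional
subspace of `ℝ³`. -/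
def IsProjLine (L : Set RP2) : Prop :=
  ∃ W : Submodule ℝ (Fin 3 → ℝ), Module.finrank ℝ W = 2 ∧ L = {p : RP2 | p.rep ∈ W}

/-- `p` lies inside the conic of `q` if every projective line through `p` meets the conic. -/
def InsideConic (q : QuadraticForm ℝ (Fin 3 → ℝ)) (p : RP2) : Prop :=
  ∀ L : Set RP2, IsProjLine L → p ∈ L → (L ∩ ConicSet q).Nonempty

/-- `p` lies outside the conic of `q` if some projective line through `p` misses the conic. -/
def OutsideConic (q : QuadraticForm ℝ (Fin 3 → ℝ)) (p : RP2) : Prop :=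
  ∃ L : Set RP2, IsProjLine L ∧ p ∈ L ∧ L ∩ ConicSet q = ∅

/-- A point `f i` of a configuration is dominant if it lies outside every conic passing
through all the other points of the configuration. -/
def Dominant {n : ℕ} (f : Fin n → RP2) (i : Fin n) : Prop :=
  ∀ q : QuadraticForm ℝ (Fin 3 → ℝ), q ≠ 0 → (∀ j, j ≠ i → q ((f j).rep) = 0) →
    OutsideConic q (f i)

/-- A point `f i` of a configuration is subdominant if it lies inside every conic passing
through all the other points of the configuration. -/
def Subdominant {n : ℕ} (f : Fin n → RP2) (i : Fin n) : Prop :=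
  ∀ q : QuadraticForm ℝ (Fin 3 → ℝ), q ≠ 0 → (∀ j, j ≠ i → q ((f j).rep) = 0) →
    InsideConic q (f i)

/-- The affine chart determined by a nonzero linear functional `φ` (with `L∞ = {φ = 0}`):
a point off `L∞` is sent to its representative rescaled to lie on the affine plane `φ = 1`. -/
def chart (φ : (Fin 3 → ℝ) →ₗ[ℝ] ℝ) (p : RP2) : Fin 3 → ℝ := (φ p.rep)⁻¹ • p.rep

/-- Convex position with respect to the affine chart of `φ`: the line `{φ = 0}` misses the
configuration, and in the chart every point lies outside the convex hull of the others. -/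
def ConvexPosWith {n : ℕ} (φ : (Fin 3 → ℝ) →ₗ[ℝ] ℝ) (f : Fin n → RP2) : Prop :=
  φ ≠ 0 ∧ (∀ i, φ (f i).rep ≠ 0) ∧
    ∀ i, chart φ (f i) ∉ convexHull ℝ (chart φ '' (f '' {j | j ≠ i}))

/-- A configuration is in convex position if it is so in some affine chart. -/
def ConvexPos {n : ℕ} (f : Fin n → RP2) : Prop := ∃ φ, ConvexPosWith φ f

/-- The labeling of a configuration is consecutive for the convex position in the chart of `φ`:
each pair `f i`, `f (i+1)` (cyclically) spans an edge of the convex polygon, i.e. is cut out by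
an affine functional which is strictly larger on both of them than on all the other points. -/
def ConsecWith {n : ℕ} [NeZero n] (φ : (Fin 3 → ℝ) →ₗ[ℝ] ℝ) (f : Fin n → RP2) : Prop :=
  ConvexPosWith φ f ∧
    ∀ i : Fin n, ∃ ψ : (Fin 3 → ℝ) →ₗ[ℝ] ℝ,
      ψ (chart φ (f i)) = ψ (chart φ (f (i + 1))) ∧
      ∀ j : Fin n, j ≠ i → j ≠ i + 1 → ψ (chart φ (f j)) < ψ (chart φ (f i))

/-- A configuration is in convex position with consecutive cyclic labeling. -/
def ConsecConvexPos {n : ℕ} [NeZero n] (f : Fin n → RP2) : Prop := ∃ φ, ConsecWith φ f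

/-- A Q-deformation (an `n`-tuple of continuous paths through typical configurations). -/
def QDeformFam (n : ℕ) (γ : Fin n → unitInterval → RP2) : Prop :=
  (∀ i, Continuous (γ i)) ∧ ∀ t : unitInterval, TypicalCfg (fun i => γ i t)

end
noncomputable section

/-- The space of labeled typical `n`-configurations (subspace of the product topology). -/
abbrev TSpace (n : ℕ) := {f : Fin n → RP2 // TypicalCfg f}

/-- Relabeling relation: the symmetric group acts by precomposition. -/
def unlabelRel (n : ℕ) (f g : TSpace n) : Prop := ∃ σ : Equiv.Perm (Fin n), f.1 = g.1 ∘ σ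

/-- The space of unlabeled typical `n`-configurations, with the quotient topology. -/
abbrev UnlabeledSpace (n : ℕ) := Quot (unlabelRel n)

namespace SixPoints

/-! ### Sign vectors of configurations -/

/-- The value of the `n`-th binary digit of `x`. -/
def bit (x n : ℕ) : Bool := Nat.beq (Nat.mod (Nat.div x (Nat.pow 2 n)) 2) 1

/-- The position of an increasing triple in the colexicographic order. -/
def colex (i j k : ℕ) : ℕ :=
  Nat.add (Nat.div (Nat.mul k (Nat.mul (Nat.sub k 1) (Nat.sub k 2))) 6)
    (Nat.add (Nat.div (Nat.mul j (Nat.sub j 1)) 2) i)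

/-- The alternating sign function whose values on increasing triples are the binary digits
of `x`; here `true` stands for a negative sign. -/
def altSign (x i j k : ℕ) : Bool :=
  bif Nat.blt i j then
    bif Nat.blt j k then bit x (colex i j k)
    else bif Nat.blt i k then !bit x (colex i k j) else bit x (colex k i j)
  else
    bif Nat.blt i k then !bit x (colex j i k)
    else bif Nat.blt j k then bit x (colex j k i) else !bit x (colex k j i)

/-- The decimal digits of `s`, used for encoding permutations. -/
def digit (s i : ℕ) : ℕ := Nat.mod (Nat.div s (Nat.pow 10 i)) 10

/-- The sign function obtained by relabeling. -/
def reindexed (x s i j k : ℕ) : Bool := altSign x (digit s i) (digit s j) (digit s k)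

/-- The signs by which the vectors have to be multiplied in order to make the
triples `012`, `013`, `023`, `123`, `014`, `015` positive. -/
def flips (c : ℕ → ℕ → ℕ → Bool) : ℕ → Bool
  | 0 => (c 0 1 2 ^^ c 0 1 3) ^^ c 0 2 3
  | 1 => (c 0 1 2 ^^ c 0 1 3) ^^ c 1 2 3
  | 2 => (c 0 1 2 ^^ c 0 2 3) ^^ c 1 2 3
  | 3 => (c 0 1 3 ^^ c 0 2 3) ^^ c 1 2 3
  | n => c 0 1 n ^^ (c 0 2 3 ^^ c 1 2 3)

/-- The sign function obtained by relabeling and normalizing the signs of the vectors. -/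
def normSign (x s i j k : ℕ) : Bool :=
  reindexed x s i j k ^^
    (flips (reindexed x s) i ^^ (flips (reindexed x s) j ^^ flips (reindexed x s) k))

/-- The sign form of the three-term Grassmann–Plücker relation with pivot `p`. -/
def plueckerSign (c : ℕ → ℕ → ℕ → Bool) (p i j k l : ℕ) : Bool :=
  !(((c p i j ^^ c p k l) ^^ (c p i l ^^ c p j k)) == false &&
    ((c p i j ^^ c p k l) ^^ (c p i k ^^ c p j l)) == true)

/-- The sign patterns of the four deformation classes. -/
def pattern : Fin 4 → ℕ := ![0, 1022 * 1024, 510 * 1024, 200 * 1024]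

/-- Encoded relabelings bringing five points into cyclic position. -/
def innerReindexings : List ℕ :=
  [543210, 534210, 542310, 524310, 532410, 523410, 543120, 534120, 541320,
    531420, 542130, 541230]

/-- Encoded relabelings bringing a configuration into one of the four standard patterns. -/
def outerReindexings : List ℕ :=
  [543210, 512340, 523401, 534012, 540123, 425310, 245301, 305412, 415023,
    452310, 135240, 254301, 243501, 504321, 304512, 315204]

/-- The increasing triples with last element at most `4`. -/
def innerTriples : List (ℕ × ℕ × ℕ) :=
  [(0, 2, 4), (0, 3, 4), (1, 2, 4), (1, 3, 4), (2, 3, 4), (0, 1, 2), (0, 1, 3), (0, 2, 3),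
    (1, 2, 3), (0, 1, 4)]

/-- The increasing triples with last element `5`. -/
def outerTriples : List (ℕ × ℕ × ℕ) :=
  [(0, 2, 5), (1, 2, 5), (0, 3, 5), (1, 3, 5), (2, 3, 5), (0, 4, 5), (1, 4, 5), (2, 4, 5),
    (3, 4, 5), (0, 1, 5)]

/-- A pivot and four further points, for Grassmann–Plücker relations among the first five points. -/
def innerRelations : List (ℕ × ℕ × ℕ × ℕ × ℕ) :=
  [(0, 1, 2, 3, 4), (1, 0, 2, 3, 4), (2, 0, 1, 3, 4), (3, 0, 1, 2, 4), (4, 0, 1, 2, 3)]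

/-- A pivot and four further points, for Grassmann–Plücker relations with the sixth point. -/
def outerRelations : List (ℕ × ℕ × ℕ × ℕ × ℕ) :=
  [(0, 1, 2, 3, 5), (0, 1, 2, 4, 5), (0, 1, 3, 4, 5), (0, 2, 3, 4, 5), (1, 0, 2, 3, 5),
    (1, 0, 2, 4, 5), (1, 0, 3, 4, 5), (1, 2, 3, 4, 5), (2, 0, 1, 3, 5), (2, 0, 1, 4, 5),
    (2, 0, 3, 4, 5), (2, 1, 3, 4, 5), (3, 0, 1, 2, 5), (3, 0, 1, 4, 5), (3, 0, 2, 4, 5),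
    (3, 1, 2, 4, 5), (4, 0, 1, 2, 5), (4, 0, 1, 3, 5), (4, 0, 2, 3, 5), (4, 1, 2, 3, 5)]

/-- The relabeled and normalized sign function agrees with `y` on the given triples. -/
def agrees (x s y : ℕ) (T : List (ℕ × ℕ × ℕ)) : Bool :=
  T.all fun t => normSign x s t.1 t.2.1 t.2.2 == bit y (colex t.1 t.2.1 t.2.2)

/-- The sign function satisfies the given Grassmann–Plücker relations. -/
def satisfies (x : ℕ) (R : List (ℕ × ℕ × ℕ × ℕ × ℕ)) : Bool :=
  R.all fun t => plueckerSign (altSign x) t.1 t.2.1 t.2.2.1 t.2.2.2.1 t.2.2.2.2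

/-- `f` holds on the `2 ^ n` numbers whose leading binary digits are those of `x`. -/
def allBelow (f : ℕ → Bool) : ℕ → ℕ → Bool
  | 0, x => f x
  | n + 1, x => allBelow f n (Nat.mul 2 x) && allBelow f n (Nat.add (Nat.mul 2 x) 1)

theorem allBelow_inner : allBelow (fun x => !satisfies (Nat.mul 32 x) innerRelations ||
    innerReindexings.any fun s => agrees (Nat.mul 32 x) s 0 innerTriples) 5 0 = true := by
  decide +kernel

theorem allBelow_outer : allBelow (fun x => !satisfies (Nat.mul 2048 x) outerRelations ||
    outerReindexings.any fun s => agrees (Nat.mul 2048 x) s 0 innerTriples &&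
      ((agrees (Nat.mul 2048 x) s (1022 * 1024) outerTriples ||
        agrees (Nat.mul 2048 x) s (510 * 1024) outerTriples) ||
      (agrees (Nat.mul 2048 x) s 0 outerTriples ||
        agrees (Nat.mul 2048 x) s (200 * 1024) outerTriples))) 9 0 = true := by
  decide +kernel

/-! ### Configurations of six vectors and their deformation classes -/

/-- Configurations of six vectors in `ℝ³`. -/
abbrev Cfg := Fin 6 → Fin 3 → ℝ

/-- The determinant of three vectors, in any commutative ring. -/
def det3 {R : Type*} [CommRing R] (u v w : Fin 3 → R) : R :=
  u 0 * (v 1 * w 2 - v 2 * w 1) - u 1 * (v 0 * w 2 - v 2 * w 0) + u 2 * (v 0 * w 1 - v 1 * w 0)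

theorem det3_eq_det (u v w : Fin 3 → ℝ) : det3 u v w = Matrix.det (Matrix.of ![u, v, w]) := by
  simp [det3, Matrix.det_fin_three]
  ring

theorem linearIndependent_iff_det3_ne_zero (u v w : Fin 3 → ℝ) :
    LinearIndependent ℝ ![u, v, w] ↔ det3 u v w ≠ 0 := by
  have h := Matrix.linearIndependent_rows_iff_isUnit (A := Matrix.of ![u, v, w])
  rw [Matrix.isUnit_iff_isUnit_det, isUnit_iff_ne_zero, ← det3_eq_det] at h
  exact h

/-- Six vectors spanning a typical configuration. -/
def Good (w : Cfg) : Prop :=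
  (∀ i j k, i ≠ j → i ≠ k → j ≠ k → det3 (w i) (w j) (w k) ≠ 0) ∧
    ∀ q : QuadraticForm ℝ (Fin 3 → ℝ), (∀ i, q (w i) = 0) → q = 0

theorem exists_distinct_pair : ∀ i : Fin 6, ∃ j k, i ≠ j ∧ i ≠ k ∧ j ≠ k := by decide

theorem exists_distinct_third : ∀ i j : Fin 6, ∃ k, i ≠ k ∧ j ≠ k := by decide

theorem Good.ne_zero {w : Cfg} (h : Good w) (i : Fin 6) : w i ≠ 0 := by
  obtain ⟨j, k, hij, hik, hjk⟩ := exists_distinct_pair i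
  intro h0
  exact h.1 i j k hij hik hjk (by simp [det3, h0])

/-- The six points spanned by six nonzero vectors. -/
def toPts (w : Cfg) (h : ∀ i, w i ≠ 0) : Fin 6 → RP2 := fun i => Projectivization.mk ℝ (w i) (h i)

theorem typicalCfg_iff (f : Fin 6 → RP2) : TypicalCfg f ↔ Good fun i => (f i).rep := by
  constructor
  · rintro ⟨⟨-, h1⟩, h2⟩
    refine ⟨fun i j k hij hik hjk => ?_, fun q hq => ?_⟩
    · have := h1 i j k hij hik hjk
      rw [Collin, not_not, linearIndependent_iff_det3_ne_zero] at this
      exact this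
    · by_contra h0
      refine h2 id Function.injective_id ⟨q, h0, ?_⟩
      rintro _ ⟨i, rfl⟩
      exact hq i
  · rintro ⟨h1, h2⟩
    refine ⟨⟨fun i j hij => ?_, fun i j k hij hik hjk => ?_⟩, fun g hg => ?_⟩
    · by_contra hne
      obtain ⟨k, hik, hjk⟩ := exists_distinct_third i j
      refine h1 i j k hne hik hjk ?_
      simp only [hij, det3]
      ring
    · rw [Collin, not_not, linearIndependent_iff_det3_ne_zero]
      exact h1 i j k hij hik hjk
    · rintro ⟨q, h0, hq⟩
      refine h0 (h2 q fun i => ?_)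
      obtain ⟨j, rfl⟩ := (Finite.injective_iff_surjective.1 hg) i
      exact hq _ ⟨j, rfl⟩

theorem Good.smul {w : Cfg} (h : Good w) {c : Fin 6 → ℝ} (hc : ∀ i, c i ≠ 0) :
    Good fun i => c i • w i := by
  refine ⟨fun i j k hij hik hjk => ?_, fun q hq => h.2 q fun i => ?_⟩
  · have e : det3 (c i • w i) (c j • w j) (c k • w k)
        = c i * c j * c k * det3 (w i) (w j) (w k) := by
      simp [det3]; ring
    rw [e]
    exact mul_ne_zero (mul_ne_zero (mul_ne_zero (hc i) (hc j)) (hc k)) (h.1 i j k hij hik hjk)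
  · have := hq i
    rw [QuadraticMap.map_smul, smul_eq_mul] at this
    exact (mul_eq_zero.1 this).resolve_left (mul_ne_zero (hc i) (hc i))

theorem Good.perm {w : Cfg} (h : Good w) (σ : Equiv.Perm (Fin 6)) : Good (w ∘ σ) := by
  refine ⟨fun i j k hij hik hjk => h.1 _ _ _ (σ.injective.ne hij) (σ.injective.ne hik)
    (σ.injective.ne hjk), fun q hq => h.2 q fun i => ?_⟩
  simpa using hq (σ.symm i)

theorem exists_rep_eq_smul (v : Fin 3 → ℝ) (hv : v ≠ 0) :
    ∃ c : ℝ, c ≠ 0 ∧ (Projectivization.mk ℝ v hv).rep = c • v := by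
  obtain ⟨a, ha⟩ := Projectivization.exists_smul_eq_mk_rep ℝ v hv
  exact ⟨a, a.ne_zero, ha.symm⟩

theorem typicalCfg_toPts_iff {w : Cfg} (h : ∀ i, w i ≠ 0) : TypicalCfg (toPts w h) ↔ Good w := by
  rw [typicalCfg_iff]
  choose c hc e using fun i => exists_rep_eq_smul (w i) (h i)
  have e' : (fun i => (toPts w h i).rep) = fun i => c i • w i := funext e
  rw [e']
  refine ⟨fun H => ?_, fun H => H.smul hc⟩
  have := H.smul (c := fun i => (c i)⁻¹) fun i => inv_ne_zero (hc i)
  simpa [smul_smul, hc] using this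

/-- The labeled typical configuration given by six vectors. -/
def toT (w : Cfg) (h : Good w) : TSpace 6 := ⟨toPts w h.ne_zero, (typicalCfg_toPts_iff _).2 h⟩

/-- The deformation class of the configuration given by six vectors. -/
def cls (w : Cfg) (h : Good w) : ZerothHomotopy (UnlabeledSpace 6) :=
  Quotient.mk (pathSetoid _) (Quot.mk (unlabelRel 6) (toT w h))

/-- Two six-tuples of vectors define the same deformation class. -/
def Rel (v w : Cfg) : Prop := ∃ (hv : Good v) (hw : Good w), cls v hv = cls w hw

theorem Rel.trans {u v w : Cfg} : Rel u v → Rel v w → Rel u w := by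
  rintro ⟨hu, hv, h⟩ ⟨hv', hw, h'⟩
  exact ⟨hu, hw, h.trans h'⟩

theorem Rel.symm {u v : Cfg} : Rel u v → Rel v u := by
  rintro ⟨hu, hv, h⟩
  exact ⟨hv, hu, h.symm⟩

theorem rel_smul {w : Cfg} (h : Good w) {c : Fin 6 → ℝ} (hc : ∀ i, c i ≠ 0) :
    Rel w fun i => c i • w i := by
  refine ⟨h, h.smul hc, ?_⟩
  have : toT w h = toT _ (h.smul hc) := by
    refine Subtype.ext (funext fun i => ?_)
    change Projectivization.mk ℝ _ _ = Projectivization.mk ℝ _ _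
    rw [Projectivization.mk_eq_mk_iff']
    exact ⟨(c i)⁻¹, by simp [smul_smul, hc i]⟩
  rw [cls, cls, this]

theorem rel_perm {w : Cfg} (h : Good w) (σ : Equiv.Perm (Fin 6)) : Rel w (w ∘ σ) := by
  refine ⟨h, h.perm σ, ?_⟩
  have : Quot.mk (unlabelRel 6) (toT _ (h.perm σ)) = Quot.mk (unlabelRel 6) (toT w h) :=
    Quot.sound ⟨σ, rfl⟩
  rw [cls, cls, this]

/-- The projection from nonzero vectors to the projective plane. -/
def proj (v : {v : Fin 3 → ℝ // v ≠ 0}) : RP2 := Projectivization.mk ℝ v.1 v.2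

theorem isQuotientMap_proj : Topology.IsQuotientMap proj := isQuotientMap_quot_mk

theorem isOpenQuotientMap_proj : IsOpenQuotientMap proj := by
  refine ⟨isQuotientMap_proj.surjective, isQuotientMap_proj.continuous, fun U hU => ?_⟩
  rw [← isQuotientMap_proj.isOpen_preimage]
  have : proj ⁻¹' (proj '' U) = ⋃ c : ℝˣ,
      (fun v : {v : Fin 3 → ℝ // v ≠ 0} => (⟨c • v.1, (smul_ne_zero_iff_ne c).2 v.2⟩ :
        {v : Fin 3 → ℝ // v ≠ 0})) ⁻¹' U := by
    ext v
    simp only [Set.mem_preimage, Set.mem_image, Set.mem_iUnion]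
    constructor
    · rintro ⟨u, hu, e⟩
      obtain ⟨a, ha⟩ := (Projectivization.mk_eq_mk_iff ℝ _ _ u.2 v.2).1 e
      exact ⟨a, by convert hu⟩
    · rintro ⟨c, hc⟩
      exact ⟨_, hc, (Projectivization.mk_eq_mk_iff ℝ _ _ _ v.2).2 ⟨c, rfl⟩⟩
  rw [this]
  refine isOpen_iUnion fun c => hU.preimage ?_
  exact Continuous.subtype_mk (continuous_subtype_val.const_smul c) _

theorem rel_path {γ : ℝ → Cfg} (hγ : Continuous γ) (h : ∀ t, 0 ≤ t → t ≤ 1 → Good (γ t)) :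
    Rel (γ 0) (γ 1) := by
  refine ⟨h 0 le_rfl zero_le_one, h 1 zero_le_one le_rfl, Quotient.sound ?_⟩
  have hc : Continuous fun t : unitInterval =>
      (Quot.mk (unlabelRel 6) (toT (γ t) (h t t.2.1 t.2.2)) : UnlabeledSpace 6) := by
    refine continuous_quot_mk.comp (Continuous.subtype_mk (continuous_pi fun i => ?_) _)
    have hi : Continuous fun t : unitInterval => γ t i :=
      (continuous_apply i).comp (hγ.comp continuous_subtype_val)
    exact isQuotientMap_proj.continuous.comp
      (hi.subtype_mk fun t => (h t t.2.1 t.2.2).ne_zero i)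
  exact ⟨⟨⟨_, hc⟩, by simp, by simp⟩⟩

theorem rel_of_convex {E : Type*} [AddCommGroup E] [Module ℝ E] [TopologicalSpace E]
    [IsTopologicalAddGroup E] [ContinuousSMul ℝ E] {S : Set E} (hS : Convex ℝ S) {Φ : E → Cfg}
    (hΦ : Continuous Φ) (h : ∀ s ∈ S, Good (Φ s)) {x y : E} (hx : x ∈ S) (hy : y ∈ S) :
    Rel (Φ x) (Φ y) := by
  have := rel_path (γ := fun t => Φ (AffineMap.lineMap x y t))
    (hΦ.comp AffineMap.lineMap_continuous)
    fun t h0 h1 => h _ (hS.lineMap_mem hx hy ⟨h0, h1⟩)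
  simpa using this

theorem Good.linear {w : Cfg} (h : Good w) {A : Matrix (Fin 3) (Fin 3) ℝ} (hA : A.det ≠ 0) :
    Good fun i => A.mulVec (w i) := by
  refine ⟨fun i j k hij hik hjk => ?_, fun q hq => ?_⟩
  · have e : det3 (A.mulVec (w i)) (A.mulVec (w j)) (A.mulVec (w k))
        = A.det * det3 (w i) (w j) (w k) := by
      simp [det3, Matrix.det_fin_three, Matrix.mulVec, dotProduct, Fin.sum_univ_three]; ring
    rw [e]
    exact mul_ne_zero hA (h.1 i j k hij hik hjk)
  · have h1 := h.2 (q.comp A.mulVecLin) fun i => hq i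
    have hA' : IsUnit A.det := isUnit_iff_ne_zero.2 hA
    ext v
    have := congrArg (fun q' : QuadraticForm ℝ (Fin 3 → ℝ) => q' (A⁻¹.mulVec v)) h1
    simpa [Matrix.mulVec_mulVec, Matrix.mul_nonsing_inv _ hA'] using this

theorem rel_matrix_path {A : ℝ → Matrix (Fin 3) (Fin 3) ℝ} (hA : Continuous A)
    (hdet : ∀ t, 0 ≤ t → t ≤ 1 → (A t).det ≠ 0) (h0 : A 0 = 1) {w : Cfg} (hw : Good w) :
    Rel w fun i => (A 1).mulVec (w i) := by
  have := rel_path (γ := fun t i => (A t).mulVec (w i))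
    (continuous_pi fun i => hA.matrix_mulVec continuous_const)
    fun t ht0 ht1 => hw.linear (hdet t ht0 ht1)
  simpa [h0] using this

theorem rel_diagonal_of_pos {D : Fin 3 → ℝ} (hD : ∀ i, 0 < D i) {w : Cfg} (hw : Good w) :
    Rel w fun i => (Matrix.diagonal D).mulVec (w i) := by
  have := rel_matrix_path (A := fun t => Matrix.diagonal fun i => 1 + t * (D i - 1))
    (by fun_prop) (fun t h0 h1 => ?_) (by simp) hw
  · simpa using this
  · rw [Matrix.det_diagonal]
    refine (Finset.prod_pos fun i _ => ?_).ne'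
    rcases h1.eq_or_lt with rfl | h1
    · linarith [hD i]
    · nlinarith [hD i]

theorem rel_halfTurn_zero {w : Cfg} (hw : Good w) :
    Rel w fun i => (Matrix.diagonal ![1, -1, -1]).mulVec (w i) := by
  have := rel_matrix_path (A := fun t => !![1, 0, 0; 0, Real.cos (t * Real.pi),
    -Real.sin (t * Real.pi); 0, Real.sin (t * Real.pi), Real.cos (t * Real.pi)])
    (by
      refine continuous_matrix fun i j => ?_
      fin_cases i <;> fin_cases j <;> simp <;> fun_prop)
    (fun t h0 h1 => by
      rw [Matrix.det_fin_three]
      simp [← pow_two])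
    (by ext i j; fin_cases i <;> fin_cases j <;> simp) hw
  convert this using 4
  ext i j; fin_cases i <;> fin_cases j <;> simp

theorem rel_halfTurn_one {w : Cfg} (hw : Good w) :
    Rel w fun i => (Matrix.diagonal ![-1, 1, -1]).mulVec (w i) := by
  have := rel_matrix_path (A := fun t => !![Real.cos (t * Real.pi), 0,
    -Real.sin (t * Real.pi); 0, 1, 0; Real.sin (t * Real.pi), 0, Real.cos (t * Real.pi)])
    (by
      refine continuous_matrix fun i j => ?_
      fin_cases i <;> fin_cases j <;> simp <;> fun_prop)
    (fun t h0 h1 => by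
      rw [Matrix.det_fin_three]
      simp [← pow_two])
    (by ext i j; fin_cases i <;> fin_cases j <;> simp) hw
  convert this using 4
  ext i j; fin_cases i <;> fin_cases j <;> simp

theorem rel_diagonal {D : Fin 3 → ℝ} (hD : ∀ i, D i ≠ 0) {w : Cfg} (hw : Good w) :
    Rel w fun i => (Matrix.diagonal D).mulVec (w i) := by
  have key : ∀ (E : Fin 3 → ℝ) (c : ℝ), c ≠ 0 → (∀ w : Cfg, Good w →
      Rel w fun i => (Matrix.diagonal E).mulVec (w i)) → (∀ i, 0 < c * E i * D i) →
      Rel w fun i => (Matrix.diagonal D).mulVec (w i) := by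
    intro E c hc hE hpos
    have hEi : ∀ i, E i ≠ 0 := fun i h => by simpa [h] using hpos i
    have h1 := hE w hw
    have hdet : (Matrix.diagonal fun i => D i / (c * E i)).det ≠ 0 := by
      rw [Matrix.det_diagonal]
      exact Finset.prod_ne_zero_iff.2 fun i _ => div_ne_zero (hD i) (mul_ne_zero hc (hEi i))
    have h2 := rel_diagonal_of_pos (D := fun i => D i / (c * E i)) (fun i => by
      have := hpos i
      have h3 : 0 < (c * E i) ^ 2 := by have := mul_ne_zero hc (hEi i); positivity
      have h4 : D i / (c * E i) = c * E i * D i / (c * E i) ^ 2 := by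
        field_simp [hEi i]
      rw [h4]; exact div_pos this h3) h1.2.1
    have h3 := (h1.trans h2).trans (rel_smul h2.2.1 (c := fun _ => c) fun _ => hc)
    convert h3 using 2
    ext j
    simp [Matrix.mulVec_diagonal]
    field_simp [hEi j]
  have hsign : ∀ i, 0 < D i ∨ 0 < -D i := fun i => by
    rcases lt_or_gt_of_ne (hD i) with h | h
    · right; linarith
    · left; exact h
  have hone : ∀ w : Cfg, Good w → Rel w fun i => (Matrix.diagonal (1 : Fin 3 → ℝ)).mulVec (w i) :=
    fun w hw => rel_diagonal_of_pos (D := 1) (fun i => by simp) hw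
  have htwo : ∀ w : Cfg, Good w →
      Rel w fun i => (Matrix.diagonal (![-1, -1, 1] : Fin 3 → ℝ)).mulVec (w i) := by
    intro w hw
    have h1 := rel_halfTurn_zero hw
    have h2 := h1.trans (rel_halfTurn_one h1.2.1)
    convert h2 using 2
    ext j
    fin_cases j <;> simp [Matrix.mulVec_diagonal]
  rcases hsign 0 with h0 | h0 <;> rcases hsign 1 with h1 | h1 <;> rcases hsign 2 with h2 | h2
  · exact key 1 1 one_ne_zero hone
      (by intro i; fin_cases i <;> simp <;> linarith)
  · exact key ![-1, -1, 1] (-1) (by norm_num) htwo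
      (by intro i; fin_cases i <;> simp <;> linarith)
  · exact key ![-1, 1, -1] (-1) (by norm_num) (fun w => rel_halfTurn_one)
      (by intro i; fin_cases i <;> simp <;> linarith)
  · exact key ![1, -1, -1] 1 (by norm_num) (fun w => rel_halfTurn_zero)
      (by intro i; fin_cases i <;> simp <;> linarith)
  · exact key ![1, -1, -1] (-1) (by norm_num) (fun w => rel_halfTurn_zero)
      (by intro i; fin_cases i <;> simp <;> linarith)
  · exact key ![-1, 1, -1] 1 (by norm_num) (fun w => rel_halfTurn_one)
      (by intro i; fin_cases i <;> simp <;> linarith)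
  · exact key ![-1, -1, 1] 1 (by norm_num) htwo
      (by intro i; fin_cases i <;> simp <;> linarith)
  · exact key 1 (-1) (by norm_num) hone
      (by intro i; fin_cases i <;> simp <;> linarith)

theorem rel_linear {A : Matrix (Fin 3) (Fin 3) ℝ} (hA : A.det ≠ 0) :
    ∀ w : Cfg, Good w → Rel w fun i => A.mulVec (w i) := by
  refine Matrix.diagonal_transvection_induction_of_det_ne_zero
    (fun A => ∀ w : Cfg, Good w → Rel w fun i => A.mulVec (w i)) A hA ?_ ?_ ?_
  · intro D hD w hw
    rw [Matrix.det_diagonal, Finset.prod_ne_zero_iff] at hD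
    exact rel_diagonal (fun i => hD i (Finset.mem_univ i)) hw
  · intro t w hw
    have := rel_matrix_path (A := fun s => Matrix.transvection t.i t.j (s * t.c))
      (by
        unfold Matrix.transvection
        refine continuous_const.add (continuous_matrix fun i j => ?_)
        simp only [Matrix.single_apply]
        split_ifs <;> fun_prop)
      (fun s _ _ => by simp [Matrix.det_transvection_of_ne _ _ t.hij])
      (by simp) hw
    simpa [Matrix.TransvectionStruct.toMatrix] using this
  · intro A B hA hB h1 h2 w hw
    have := (h2 w hw).trans (h1 _ (hw.linear hB))
    simpa [Matrix.mulVec_mulVec] using this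

/-! ### Reduction to the four standard sign patterns -/

/-- Whether the determinant of three vectors of the configuration is negative. -/
def sgn (w : Cfg) (i j k : Fin 6) : Bool := decide (det3 (w i) (w j) (w k) < 0)

theorem xor_decide_neg {a b : ℝ} (ha : a ≠ 0) (hb : b ≠ 0) :
    (decide (a < 0) ^^ decide (b < 0)) = decide (a * b < 0) := by
  rcases lt_or_gt_of_ne ha with h | h <;> rcases lt_or_gt_of_ne hb with h' | h' <;>
    simp [h, h', not_lt_of_gt, mul_pos_of_neg_of_neg, mul_neg_of_pos_of_neg,
      mul_neg_of_neg_of_pos]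

theorem sgn_swap_left {w : Cfg} (hw : Good w) {i j k : Fin 6} (hij : i ≠ j) (hik : i ≠ k)
    (hjk : j ≠ k) : sgn w j i k = !sgn w i j k := by
  have h := hw.1 i j k hij hik hjk
  have e : det3 (w j) (w i) (w k) = -det3 (w i) (w j) (w k) := by simp only [det3]; ring
  rcases lt_or_gt_of_ne h with h | h <;> simp [sgn, e, h, h.le]

theorem sgn_swap_right {w : Cfg} (hw : Good w) {i j k : Fin 6} (hij : i ≠ j) (hik : i ≠ k)
    (hjk : j ≠ k) : sgn w i k j = !sgn w i j k := by
  have h := hw.1 i j k hij hik hjk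
  have e : det3 (w i) (w k) (w j) = -det3 (w i) (w j) (w k) := by simp only [det3]; ring
  rcases lt_or_gt_of_ne h with h | h <;> simp [sgn, e, h, h.le]

/-- The binary digits of `x` record the signs of the triples of the first `n` vectors. -/
def HasBits (n x : ℕ) (w : Cfg) : Prop :=
  ∀ i j k : Fin 6, i < j → j < k → (k : ℕ) < n → bit x (colex i j k) = sgn w i j k

theorem HasBits.altSign_eq {n x : ℕ} {w : Cfg} (h : HasBits n x w) (hw : Good w) {i j k : Fin 6}
    (hi : (i : ℕ) < n) (hj : (j : ℕ) < n) (hk : (k : ℕ) < n) (hij : i ≠ j) (hik : i ≠ k)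
    (hjk : j ≠ k) : altSign x i j k = sgn w i j k := by
  have blt : ∀ a b : Fin 6, Nat.blt a b = decide (a < b) := fun a b => by
    rw [Bool.eq_iff_iff, Nat.blt_eq, decide_eq_true_iff, Fin.lt_def]
  simp only [altSign, blt]
  rcases lt_or_gt_of_ne hij with h1 | h1 <;> rcases lt_or_gt_of_ne hik with h2 | h2 <;>
    rcases lt_or_gt_of_ne hjk with h3 | h3 <;> simp only [h1, h2, h3, not_lt_of_gt, decide_true,
      decide_false, cond_true, cond_false]
  · exact h i j k h1 h3 hk
  · rw [h i k j h2 h3 hj, sgn_swap_right hw hij hik hjk, Bool.not_not]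
  · exact absurd (h1.trans h3) (not_lt_of_gt h2)
  · rw [h k i j h2 h1 hj, sgn_swap_left hw hik hij hjk.symm, sgn_swap_right hw hij hik hjk,
      Bool.not_not]
  · rw [h j i k h1 h2 hk, sgn_swap_left hw hij hik hjk, Bool.not_not]
  · exact absurd (h2.trans h3) (not_lt_of_gt h1)
  · rw [h j k i h3 h2 hi, sgn_swap_right hw hij.symm hjk hik, sgn_swap_left hw hij hik hjk,
      Bool.not_not]
  · rw [h k j i h3 h1 hi, sgn_swap_right hw hik.symm hjk.symm hij, sgn_swap_left hw hik hij hjk.symm,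
      sgn_swap_right hw hij hik hjk]
    simp

theorem bit_eq_testBit (x n : ℕ) : bit x n = x.testBit n := by
  change Nat.beq (x / 2 ^ n % 2) 1 = _
  rw [Nat.testBit_eq_decide_div_mod_eq, Bool.eq_iff_iff]
  simp

theorem colex_injective : ∀ i j k i' j' k' : Fin 6, i < j → j < k → i' < j' → j' < k' →
    colex i j k = colex i' j' k' → i = i' ∧ j = j' ∧ k = k' := by
  decide +kernel

theorem exists_bits (w : Cfg) (a b : ℕ)
    (h : ∀ i j k : Fin 6, i < j → j < k → colex i j k < a → sgn w i j k = false) :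
    ∃ y < 2 ^ b, ∀ i j k : Fin 6, i < j → j < k → colex i j k < a + b →
      bit (2 ^ a * y) (colex i j k) = sgn w i j k := by
  classical
  refine ⟨Nat.ofBits fun m : Fin b => decide (∃ i j k : Fin 6, i < j ∧ j < k ∧
    colex i j k = m + a ∧ sgn w i j k = true), Nat.ofBits_lt_two_pow _, fun i j k hij hjk hb => ?_⟩
  rw [bit_eq_testBit, Nat.testBit_two_pow_mul]
  rcases lt_or_ge (colex i j k) a with ha | ha
  · simp [h i j k hij hjk ha, ha]
  · rw [Nat.testBit_ofBits_lt _ _ (by omega), Bool.eq_iff_iff]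
    simp only [ha, decide_true, Bool.true_and, decide_eq_true_eq]
    constructor
    · rintro ⟨i', j', k', h1, h2, h3, h4⟩
      obtain ⟨rfl, rfl, rfl⟩ := colex_injective i j k i' j' k' hij hjk h1 h2
        (by omega)
      exact h4
    · exact fun hs => ⟨i, j, k, hij, hjk, by omega, hs⟩

theorem allBelow_sound {f : ℕ → Bool} : ∀ {n x : ℕ}, allBelow f n x = true →
    ∀ y < 2 ^ n, f (2 ^ n * x + y) = true
  | 0, x, h, y, hy => by
    obtain rfl : y = 0 := by simpa using hy
    simpa [allBelow] using h
  | n + 1, x, h, y, hy => by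
    rw [allBelow, Bool.and_eq_true] at h
    rw [pow_succ] at hy ⊢
    rcases lt_or_ge y (2 ^ n) with h1 | h1
    · have := allBelow_sound h.1 y h1
      rwa [show 2 ^ n * 2 * x + y = 2 ^ n * Nat.mul 2 x + y by simp only [Nat.mul_eq]; ring]
    · have := allBelow_sound h.2 (y - 2 ^ n) (by omega)
      rwa [show 2 ^ n * 2 * x + y = 2 ^ n * (Nat.add (Nat.mul 2 x) 1) + (y - 2 ^ n) by
        simp only [Nat.mul_eq, Nat.add_eq]; zify [h1]; ring]

theorem HasBits.plueckerSign_eq {n x : ℕ} {w : Cfg} (h : HasBits n x w) (hw : Good w)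
    {p i j k l : ℕ} (hn : n ≤ 6) (hlt : ∀ a ∈ [p, i, j, k, l], a < n)
    (hd : [p, i, j, k, l].Nodup) : plueckerSign (altSign x) p i j k l = true := by
  simp only [List.mem_cons, List.not_mem_nil, or_false, forall_eq_or_imp, forall_eq] at hlt
  simp only [List.nodup_cons, List.mem_cons, List.not_mem_nil, or_false, not_or, not_false_eq_true,
    List.nodup_nil, and_true] at hd
  obtain ⟨hp, hi, hj, hk, hl⟩ := hlt
  lift p to Fin 6 using hp.trans_le hn
  lift i to Fin 6 using hi.trans_le hn
  lift j to Fin 6 using hj.trans_le hn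
  lift k to Fin 6 using hk.trans_le hn
  lift l to Fin 6 using hl.trans_le hn
  simp only [Fin.val_inj] at hd
  obtain ⟨⟨hpi, hpj, hpk, hpl⟩, ⟨hij, hik, hil⟩, ⟨hjk, hjl⟩, hkl⟩ := hd
  have e : ∀ {a b : Fin 6}, (a : ℕ) < n → (b : ℕ) < n → p ≠ a → p ≠ b → a ≠ b →
      altSign x p a b = sgn w p a b := fun ha hb h1 h2 h3 => h.altSign_eq hw hp ha hb h1 h2 h3
  have d : ∀ {a b : Fin 6}, p ≠ a → p ≠ b → a ≠ b → det3 (w p) (w a) (w b) ≠ 0 :=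
    fun h1 h2 h3 => hw.1 _ _ _ h1 h2 h3
  rw [plueckerSign, e hi hj hpi hpj hij, e hk hl hpk hpl hkl, e hi hl hpi hpl hil,
    e hj hk hpj hpk hjk, e hi hk hpi hpk hik, e hj hl hpj hpl hjl]
  simp only [sgn]
  rw [xor_decide_neg (d hpi hpj hij) (d hpk hpl hkl), xor_decide_neg (d hpi hpl hil) (d hpj hpk hjk),
    xor_decide_neg (d hpi hpk hik) (d hpj hpl hjl)]
  have hX := mul_ne_zero (d hpi hpj hij) (d hpk hpl hkl)
  have hY := mul_ne_zero (d hpi hpk hik) (d hpj hpl hjl)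
  have hZ := mul_ne_zero (d hpi hpl hil) (d hpj hpk hjk)
  have rel : det3 (w p) (w i) (w j) * det3 (w p) (w k) (w l)
      - det3 (w p) (w i) (w k) * det3 (w p) (w j) (w l)
      + det3 (w p) (w i) (w l) * det3 (w p) (w j) (w k) = 0 := by
    simp only [det3]; ring
  generalize det3 (w p) (w i) (w j) * det3 (w p) (w k) (w l) = X at *
  generalize det3 (w p) (w i) (w k) * det3 (w p) (w j) (w l) = Y at *
  generalize det3 (w p) (w i) (w l) * det3 (w p) (w j) (w k) = Z at *
  rcases lt_or_gt_of_ne hX with h1 | h1 <;> rcases lt_or_gt_of_ne hY with h2 | h2 <;>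
    rcases lt_or_gt_of_ne hZ with h3 | h3 <;> first
      | (exfalso; linarith)
      | simp [h1, h2, h3, not_lt_of_gt]

theorem HasBits.satisfies_eq {n x : ℕ} {w : Cfg} (h : HasBits n x w) (hw : Good w) (hn : n ≤ 6)
    {R : List (ℕ × ℕ × ℕ × ℕ × ℕ)}
    (hR : ∀ t ∈ R, (∀ a ∈ [t.1, t.2.1, t.2.2.1, t.2.2.2.1, t.2.2.2.2], a < n) ∧
      [t.1, t.2.1, t.2.2.1, t.2.2.2.1, t.2.2.2.2].Nodup) : satisfies x R = true := by
  rw [satisfies, List.all_eq_true]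
  exact fun t ht => h.plueckerSign_eq hw hn (hR t ht).1 (hR t ht).2

/-- The decimal digits of `s` encode a permutation preserving the numbers below `n`. -/
def validCode (n s : ℕ) : Bool :=
  (List.range 6).all fun i => Nat.blt (digit s i) 6 &&
    ((!Nat.blt i n || Nat.blt (digit s i) n) &&
    (List.range 6).all fun j => Nat.beq i j || !Nat.beq (digit s i) (digit s j))

theorem validCode_inner : (543210 :: innerReindexings).all (validCode 5) = true := by
  decide +kernel

theorem validCode_outer : (543210 :: outerReindexings).all (validCode 6) = true := by
  decide +kernel

theorem exists_perm_of_validCode {n s : ℕ} (h : validCode n s = true) :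
    ∃ σ : Equiv.Perm (Fin 6), (∀ i, (σ i : ℕ) = digit s i) ∧
      ∀ i : Fin 6, (i : ℕ) < n → (σ i : ℕ) < n := by
  have blt : ∀ a b : ℕ, Nat.blt a b = decide (a < b) := fun a b => by
    rw [Bool.eq_iff_iff, Nat.blt_eq, decide_eq_true_iff]
  have beq : ∀ a b : ℕ, Nat.beq a b = decide (a = b) := fun a b => by
    rw [Bool.eq_iff_iff]; simp
  simp only [validCode, List.all_eq_true, List.mem_range, blt, beq, Bool.and_eq_true,
    Bool.or_eq_true, Bool.not_eq_true', decide_eq_true_eq, decide_eq_false_iff_not] at h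
  have hinj : Function.Injective fun i : Fin 6 => (⟨digit s i, (h i i.2).1⟩ : Fin 6) := by
    intro i j hij
    exact Fin.ext (((h i i.2).2.2 j j.2).resolve_right (not_not.2 (Fin.mk.inj hij)))
  refine ⟨Equiv.ofBijective _ (Finite.injective_iff_bijective.1 hinj), fun i => rfl,
    fun i hi => ((h i i.2).2.1).resolve_left (not_not.2 hi)⟩

theorem exists_rel_normSign {n s x : ℕ} {w : Cfg} (hw : Good w) (h : HasBits n x w)
    (hs : validCode n s = true) : ∃ w', Rel w w' ∧ ∀ i j k : Fin 6, i < j → j < k → (k : ℕ) < n →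
      sgn w' i j k = normSign x s i j k := by
  obtain ⟨σ, hσ, hn⟩ := exists_perm_of_validCode hs
  have h1 := rel_perm hw σ
  have h2 := rel_smul h1.2.1 (c := fun i => bif flips (reindexed x s) i then -1 else 1)
    (fun i => by cases flips (reindexed x s) i <;> simp)
  refine ⟨_, h1.trans h2, fun i j k hij hjk hk => ?_⟩
  have hj : (j : ℕ) < n := lt_trans hjk hk
  have hi : (i : ℕ) < n := lt_trans hij hj
  have e : reindexed x s i j k = sgn w (σ i) (σ j) (σ k) := by
    rw [reindexed, ← hσ, ← hσ, ← hσ]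
    exact h.altSign_eq hw (hn i hi) (hn j hj) (hn k hk) (σ.injective.ne hij.ne)
      (σ.injective.ne (hij.trans hjk).ne) (σ.injective.ne hjk.ne)
  have hne := h1.2.1.1 i j k hij.ne (hij.trans hjk).ne hjk.ne
  simp only [Function.comp_apply] at hne
  rw [normSign, e]
  have hscale : ∀ a b c : ℝ, det3 (a • w (σ i)) (b • w (σ j)) (c • w (σ k))
      = a * b * c * det3 (w (σ i)) (w (σ j)) (w (σ k)) := fun a b c => by
    simp [det3]; ring
  simp only [sgn, Function.comp_apply, hscale]
  generalize det3 (w (σ i)) (w (σ j)) (w (σ k)) = d at *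
  cases flips (reindexed x s) i <;> cases flips (reindexed x s) j <;> cases flips (reindexed x s) k <;>
    rcases lt_or_gt_of_ne hne with hd | hd <;> simp [hd, not_lt_of_gt]

theorem colex_lt_ten : ∀ i j k : Fin 6, i < j → j < k → (k : ℕ) < 5 → colex i j k < 10 := by
  decide +kernel

theorem colex_lt_twenty : ∀ i j k : Fin 6, i < j → j < k → colex i j k < 20 := by
  decide +kernel

theorem normSign_of_colex_lt_five (x s : ℕ) : ∀ i j k : Fin 6, i < j → j < k →
    colex i j k < 5 → normSign x s i j k = false := by
  have key : ∀ i j k : Fin 6, i < j → j < k → colex i j k < 5 →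
      (i, j, k) ∈ [((0 : Fin 6), (1 : Fin 6), (2 : Fin 6)), (0, 1, 3), (0, 2, 3), (1, 2, 3),
        (0, 1, 4)] := by decide +kernel
  intro i j k hij hjk h
  have := key i j k hij hjk h
  simp only [List.mem_cons, Prod.mk.injEq, List.not_mem_nil, or_false] at this
  obtain ⟨rfl, rfl, rfl⟩ | ⟨rfl, rfl, rfl⟩ | ⟨rfl, rfl, rfl⟩ | ⟨rfl, rfl, rfl⟩ | ⟨rfl, rfl, rfl⟩ :=
    this <;>
  · simp only [normSign, flips, Fin.val_zero, Fin.val_one, Fin.val_two,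
      show ((3 : Fin 6) : ℕ) = 3 from rfl, show ((4 : Fin 6) : ℕ) = 4 from rfl]
    cases reindexed x s 0 1 2 <;> cases reindexed x s 0 1 3 <;> cases reindexed x s 0 2 3 <;>
      cases reindexed x s 1 2 3 <;> try cases reindexed x s 0 1 4
    all_goals rfl

theorem exists_rel_inner {w : Cfg} (hw : Good w) : ∃ w', Rel w w' ∧
    ∀ i j k : Fin 6, i < j → j < k → colex i j k < 11 → sgn w' i j k = false := by
  obtain ⟨x, -, hx⟩ := exists_bits w 0 20 (by simp)
  obtain ⟨w₁, h1, h1'⟩ := exists_rel_normSign (n := 6) (s := 543210) (x := x) hw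
    (fun i j k hij hjk _ => by simpa using hx i j k hij hjk (by simpa using colex_lt_twenty i j k hij hjk))
    (List.all_eq_true.1 validCode_outer _ (by simp))
  obtain ⟨y, hy, hy'⟩ := exists_bits w₁ 5 5 fun i j k hij hjk h => by
    rw [h1' i j k hij hjk k.2, normSign_of_colex_lt_five x _ i j k hij hjk h]
  have hb : HasBits 5 (32 * y) w₁ := fun i j k hij hjk hk =>
    hy' i j k hij hjk (colex_lt_ten i j k hij hjk hk)
  have hc := allBelow_sound allBelow_inner y hy
  simp only [Nat.mul_eq, mul_zero, zero_add] at hc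
  rw [hb.satisfies_eq h1.2.1 (by norm_num) (by decide +kernel), Bool.not_true, Bool.false_or,
    List.any_eq_true] at hc
  obtain ⟨s, hs, ha⟩ := hc
  obtain ⟨w₂, h2, h2'⟩ := exists_rel_normSign h1.2.1 hb
    (List.all_eq_true.1 validCode_inner s (List.mem_cons_of_mem _ hs))
  have h3 := rel_smul h2.2.1 (c := fun i => if i = 5 ∧ sgn w₂ 0 1 5 = true then -1 else 1)
    (fun i => by split_ifs <;> simp)
  refine ⟨_, (h1.trans h2).trans h3, fun i j k hij hjk h => ?_⟩
  have key : ∀ i j k : Fin 6, i < j → j < k → colex i j k < 11 →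
      ((k : ℕ) < 5 ∧ ((i : ℕ), (j : ℕ), (k : ℕ)) ∈ innerTriples ∧ bit 0 (colex i j k) = false) ∨
        (i = 0 ∧ j = 1 ∧ k = 5) := by decide +kernel
  rcases key i j k hij hjk h with ⟨hk, hm, h0⟩ | ⟨rfl, rfl, rfl⟩
  · have hk5 : k ≠ 5 := by rintro rfl; exact absurd hk (by decide)
    have hj : (j : ℕ) < 5 := lt_trans hjk hk
    have hi : (i : ℕ) < 5 := lt_trans hij hj
    have hj5 : j ≠ 5 := by rintro rfl; exact absurd hj (by decide)
    have hi5 : i ≠ 5 := by rintro rfl; exact absurd hi (by decide)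
    have := List.all_eq_true.1 ha _ hm
    simp only [beq_iff_eq, h0] at this
    rw [← h2' i j k hij hjk hk] at this
    simpa [sgn, hk5, hj5, hi5] using this
  · have hne := h2.2.1.1 0 1 5 (by decide) (by decide) (by decide)
    rcases lt_or_gt_of_ne hne with hd | hd
    · have e : sgn w₂ 0 1 5 = true := by simpa [sgn] using hd
      have : det3 (w₂ 0) (w₂ 1) (-w₂ 5) = -det3 (w₂ 0) (w₂ 1) (w₂ 5) := by
        simp [det3]; ring
      simp [sgn, hd, this, hd.le]
    · have e : sgn w₂ 0 1 5 = false := by simpa [sgn] using hd.le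
      simp only [e, Bool.false_eq_true, and_false, if_false, one_smul]

theorem exists_rel_pattern {w : Cfg} (hw : Good w) : ∃ (m : Fin 4) (w' : Cfg), Rel w w' ∧
    ∀ i j k : Fin 6, i < j → j < k → sgn w' i j k = bit (pattern m) (colex i j k) := by
  obtain ⟨w₁, h1, h1'⟩ := exists_rel_inner hw
  obtain ⟨y, hy, hy'⟩ := exists_bits w₁ 11 9 h1'
  have hb : HasBits 6 (2048 * y) w₁ := fun i j k hij hjk hk =>
    hy' i j k hij hjk (colex_lt_twenty i j k hij hjk)
  have hc := allBelow_sound allBelow_outer y hy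
  simp only [Nat.mul_eq, mul_zero, zero_add] at hc
  rw [hb.satisfies_eq h1.2.1 (by norm_num) (by decide +kernel), Bool.not_true, Bool.false_or,
    List.any_eq_true] at hc
  obtain ⟨s, hs, ha⟩ := hc
  obtain ⟨w₂, h2, h2'⟩ := exists_rel_normSign h1.2.1 hb
    (List.all_eq_true.1 validCode_outer s (List.mem_cons_of_mem _ hs))
  rw [Bool.and_eq_true] at ha
  have ho : ∃ m, agrees (2048 * y) s (pattern m) outerTriples = true := by
    simp only [Bool.or_eq_true] at ha
    rcases ha.2 with (h | h) | (h | h)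
    exacts [⟨1, h⟩, ⟨2, h⟩, ⟨0, h⟩, ⟨3, h⟩]
  obtain ⟨m, hm⟩ := ho
  refine ⟨m, w₂, h1.trans h2, fun i j k hij hjk => ?_⟩
  have key : ∀ m, ∀ i j k : Fin 6, i < j → j < k →
      ((i : ℕ), (j : ℕ), (k : ℕ)) ∈ outerTriples ∨
        (((i : ℕ), (j : ℕ), (k : ℕ)) ∈ innerTriples ∧
          bit 0 (colex i j k) = bit (pattern m) (colex i j k)) := by decide +kernel
  rw [h2' i j k hij hjk k.2]
  rcases key m i j k hij hjk with h | ⟨h, h0⟩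
  · simpa using List.all_eq_true.1 hm _ h
  · rw [← h0]
    simpa using List.all_eq_true.1 ha.1 _ h

/-! ### Normal forms -/

/-- Configurations whose first four vectors form a standard projective frame. -/
def framed (a b c x y z : ℝ) : Cfg :=
  ![![1, 0, 0], ![0, 1, 0], ![0, 0, 1], ![1, -1, 1], ![a, -b, c], ![x, -y, z]]

theorem det3_mulVec (A : Matrix (Fin 3) (Fin 3) ℝ) (r s t : ℝ) (u v w : Fin 3 → ℝ) :
    det3 (r • A.mulVec u) (s • A.mulVec v) (t • A.mulVec w)
      = A.det * (r * s * t) * det3 u v w := by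
  simp [det3, Matrix.det_fin_three, Matrix.mulVec, dotProduct, Fin.sum_univ_three]
  ring

theorem exists_rel_framed {w : Cfg} (hw : Good w) (h012 : 0 < det3 (w 0) (w 1) (w 2))
    (h013 : 0 < det3 (w 0) (w 1) (w 3)) (h023 : 0 < det3 (w 0) (w 2) (w 3))
    (h123 : 0 < det3 (w 1) (w 2) (w 3)) :
    ∃ a b c x y z, Rel w (framed a b c x y z) ∧ ∃ (δ : ℝ) (r : Fin 6 → ℝ), 0 < δ ∧
      (∀ i, 0 < r i) ∧ ∀ i j k, det3 (framed a b c x y z i) (framed a b c x y z j)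
        (framed a b c x y z k) = δ * (r i * r j * r k) * det3 (w i) (w j) (w k) := by
  obtain ⟨d, hd⟩ : ∃ d, d = det3 (w 0) (w 1) (w 2) := ⟨_, rfl⟩
  obtain ⟨d₀, hd0⟩ : ∃ d, d = det3 (w 1) (w 2) (w 3) := ⟨_, rfl⟩
  obtain ⟨d₁, hd1⟩ : ∃ d, d = det3 (w 0) (w 2) (w 3) := ⟨_, rfl⟩
  obtain ⟨d₂, hd2⟩ : ∃ d, d = det3 (w 0) (w 1) (w 3) := ⟨_, rfl⟩
  rw [← hd] at h012
  rw [← hd0] at h123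
  rw [← hd1] at h023
  rw [← hd2] at h013
  let A : Matrix (Fin 3) (Fin 3) ℝ := Matrix.of
    ![fun l => det3 (Pi.single l 1) (w 1) (w 2) / d₀, fun l => det3 (w 0) (Pi.single l 1) (w 2) / d₁,
      fun l => det3 (w 0) (w 1) (Pi.single l 1) / d₂]
  have hA : ∀ v, A.mulVec v = ![det3 v (w 1) (w 2) / d₀, det3 (w 0) v (w 2) / d₁,
      det3 (w 0) (w 1) v / d₂] := by
    intro v
    ext l
    fin_cases l <;>
    · simp [A, Matrix.mulVec, dotProduct, Fin.sum_univ_three, det3]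
      ring
  have h0 : (d₀ / d) • A.mulVec (w 0) = ![1, 0, 0] := by
    rw [hA, ← hd, show det3 (w 0) (w 0) (w 2) = 0 by simp only [det3]; ring,
      show det3 (w 0) (w 1) (w 0) = 0 by simp only [det3]; ring]
    ext l
    fin_cases l <;>
    · simp
      try field_simp
  have h1 : (d₁ / d) • A.mulVec (w 1) = ![0, 1, 0] := by
    rw [hA, ← hd, show det3 (w 1) (w 1) (w 2) = 0 by simp only [det3]; ring,
      show det3 (w 0) (w 1) (w 1) = 0 by simp only [det3]; ring]
    ext l
    fin_cases l <;>
    · simp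
      try field_simp
  have h2 : (d₂ / d) • A.mulVec (w 2) = ![0, 0, 1] := by
    rw [hA, ← hd, show det3 (w 2) (w 1) (w 2) = 0 by simp only [det3]; ring,
      show det3 (w 0) (w 2) (w 2) = 0 by simp only [det3]; ring]
    ext l
    fin_cases l <;>
    · simp
      try field_simp
  have h3 : A.mulVec (w 3) = ![1, -1, 1] := by
    rw [hA, ← hd2, show det3 (w 3) (w 1) (w 2) = d₀ by rw [hd0]; simp only [det3]; ring,
      show det3 (w 0) (w 3) (w 2) = -d₁ by rw [hd1]; simp only [det3]; ring]
    ext l; fin_cases l <;> simp [h123.ne', h023.ne', h013.ne']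
  have hdet : 0 < A.det := by
    have := det3_mulVec A (d₀ / d) (d₁ / d) (d₂ / d) (w 0) (w 1) (w 2)
    rw [h0, h1, h2, ← hd] at this
    have h' : 0 < A.det * (d₀ / d * (d₁ / d) * (d₂ / d)) * d := by
      rw [← this]; simp [det3]
    have h'' : 0 < d₀ / d * (d₁ / d) * (d₂ / d) := by positivity
    exact pos_of_mul_pos_left (pos_of_mul_pos_left h' h012.le) h''.le
  let r : Fin 6 → ℝ := ![d₀ / d, d₁ / d, d₂ / d, 1, 1, 1]
  have hr : ∀ i, 0 < r i := by
    intro i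
    fin_cases i <;> simp [r] <;> positivity
  have e : framed (A.mulVec (w 4) 0) (-A.mulVec (w 4) 1) (A.mulVec (w 4) 2)
      (A.mulVec (w 5) 0) (-A.mulVec (w 5) 1) (A.mulVec (w 5) 2)
      = fun i => r i • A.mulVec (w i) := by
    ext i l
    fin_cases i
    · exact congrFun h0.symm l
    · exact congrFun h1.symm l
    · exact congrFun h2.symm l
    · exact (congrFun h3.symm l).trans (by simp [r])
    · fin_cases l <;> simp [framed, r]
    · fin_cases l <;> simp [framed, r]
  refine ⟨A.mulVec (w 4) 0, -A.mulVec (w 4) 1, A.mulVec (w 4) 2, A.mulVec (w 5) 0,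
    -A.mulVec (w 5) 1, A.mulVec (w 5) 2, ?_, A.det, r, hdet, hr, fun i j k => ?_⟩
  · rw [e]
    have h1 := rel_linear hdet.ne' w hw
    exact h1.trans (rel_smul h1.2.1 fun i => (hr i).ne')
  · rw [e]
    exact det3_mulVec A _ _ _ _ _ _

/-- The cubic form whose vanishing means that the six points lie on a conic. -/
def conicForm (a b c x y z : ℝ) : ℝ :=
  a * (b - c) * (y * z) + b * (c - a) * (x * z) + c * (a - b) * (x * y)

theorem quadraticForm_fin_three (q : QuadraticForm ℝ (Fin 3 → ℝ)) (h0 : q ![1, 0, 0] = 0)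
    (h1 : q ![0, 1, 0] = 0) (h2 : q ![0, 0, 1] = 0) : ∃ α β γ : ℝ, ∀ v : Fin 3 → ℝ,
      q v = α * (v 1 * v 2) + β * (v 0 * v 2) + γ * (v 0 * v 1) := by
  refine ⟨QuadraticMap.polar q ![0, 1, 0] ![0, 0, 1], QuadraticMap.polar q ![1, 0, 0] ![0, 0, 1],
    QuadraticMap.polar q ![1, 0, 0] ![0, 1, 0], fun v => ?_⟩
  have e : v = v 0 • ![1, 0, 0] + v 1 • ![0, 1, 0] + v 2 • ![0, 0, 1] := by
    ext l; fin_cases l <;> simp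
  conv_lhs => rw [e]
  rw [QuadraticMap.map_add q, QuadraticMap.map_add q, QuadraticMap.polar_add_left,
    QuadraticMap.map_smul, QuadraticMap.map_smul, QuadraticMap.map_smul, h0, h1, h2]
  simp only [QuadraticMap.polar_smul_left, QuadraticMap.polar_smul_right, smul_eq_mul]
  ring

theorem Good.conicForm_ne_zero {a b c x y z : ℝ} (hb : 0 < b) (hca : c < a)
    (h : Good (framed a b c x y z)) : conicForm a b c x y z ≠ 0 := by
  intro h0
  let q : QuadraticForm ℝ (Fin 3 → ℝ) :=
    (-(a * (b - c))) • QuadraticMap.linMulLin (LinearMap.proj 1) (LinearMap.proj 2)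
      + (b * (c - a)) • QuadraticMap.linMulLin (LinearMap.proj 0) (LinearMap.proj 2)
      + (-(c * (a - b))) • QuadraticMap.linMulLin (LinearMap.proj 0) (LinearMap.proj 1)
  have hq : ∀ v, q v = -(a * (b - c)) * (v 1 * v 2) + b * (c - a) * (v 0 * v 2)
      + -(c * (a - b)) * (v 0 * v 1) := fun v => by simp [q]
  have := h.2 q fun i => by
    rw [hq]
    unfold conicForm at h0
    fin_cases i <;> simp [framed] <;> linarith
  have h1 := hq ![1, 0, 1]
  rw [this] at h1
  simp at h1
  rcases h1 with h1 | h1 <;> linarith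

theorem good_of_forall_lt {w : Cfg} (h : ∀ i j k, i < j → j < k → det3 (w i) (w j) (w k) ≠ 0)
    (hq : ∀ q : QuadraticForm ℝ (Fin 3 → ℝ), (∀ i, q (w i) = 0) → q = 0) : Good w := by
  refine ⟨fun i j k hij hik hjk h0 => ?_, hq⟩
  rcases lt_or_gt_of_ne hij with h1 | h1 <;> rcases lt_or_gt_of_ne hik with h2 | h2 <;>
    rcases lt_or_gt_of_ne hjk with h3 | h3
  · exact h i j k h1 h3 h0
  · exact h i k j h2 h3 (by simp only [det3] at h0 ⊢; linarith)
  · exact absurd (h1.trans h3) (not_lt_of_gt h2)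
  · exact h k i j h2 h1 (by simp only [det3] at h0 ⊢; linarith)
  · exact h j i k h1 h2 (by simp only [det3] at h0 ⊢; linarith)
  · exact absurd (h2.trans h3) (not_lt_of_gt h1)
  · exact h j k i h3 h2 (by simp only [det3] at h0 ⊢; linarith)
  · exact h k j i h3 h1 (by simp only [det3] at h0 ⊢; linarith)

/-- The determinants of two of the first five vectors and the sixth one. -/
def forms (a b c x y z : ℝ) : Fin 10 → ℝ :=
  ![z, y, x, y - z, x - z, x - y, c * y - b * z, c * x - a * z, b * x - a * y,
    x * (b - c) + y * (c - a) + z * (a - b)]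

theorem good_framed {a b c x y z : ℝ} (hc : 0 < c) (hbc : c < b) (hab : b < a)
    (h : ∀ n, forms a b c x y z n ≠ 0) (hC : conicForm a b c x y z ≠ 0) :
    Good (framed a b c x y z) := by
  refine good_of_forall_lt (fun i j k hij hjk => ?_) fun q hq => ?_
  · have h0 := h 0
    have h1 := h 1
    have h2 := h 2
    have h3 := h 3
    have h4 := h 4
    have h5 := h 5
    have h6 := h 6
    have h7 := h 7
    have h8 := h 8
    have h9 := h 9
    simp [forms] at h0 h1 h2 h3 h4 h5 h6 h7 h8 h9
    fin_cases i <;> fin_cases j <;> first | (exfalso; revert hij; decide) | skip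
    all_goals fin_cases k <;> first | (exfalso; revert hjk; decide) | skip
    all_goals
      simp [framed, det3] <;> first
        | assumption
        | (intro h'; linarith)
        | (intro h'; apply h3; linarith)
        | (intro h'; apply h5; linarith)
        | (intro h'; apply h6; linarith)
        | (intro h'; apply h8; linarith)
        | (intro h'; apply h9; linarith)
  · obtain ⟨α, β, γ, hv⟩ := quadraticForm_fin_three q (hq 0) (hq 1) (hq 2)
    have e1 := hq 3
    have e2 := hq 4
    have e3 := hq 5
    rw [hv] at e1 e2 e3
    simp [framed] at e1 e2 e3
    have hα : α = 0 := by
      refine (mul_eq_zero.1 (?_ : conicForm a b c x y z * α = 0)).resolve_left hC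
      unfold conicForm
      linear_combination -(a * c * (x * y) - a * b * (x * z)) * e1 + (x * y - x * z) * e2
        - (a * b - a * c) * e3
    have hβ : β = 0 := by
      refine (mul_eq_zero.1 (?_ : conicForm a b c x y z * β = 0)).resolve_left hC
      unfold conicForm
      linear_combination -(b * c * (x * y) - a * b * (y * z)) * e1 + (x * y - y * z) * e2
        - (a * b - b * c) * e3
    have hγ : γ = 0 := by
      refine (mul_eq_zero.1 (?_ : conicForm a b c x y z * γ = 0)).resolve_left hC
      unfold conicForm
      linear_combination -(b * c * (x * z) - a * c * (y * z)) * e1 + (x * z - y * z) * e2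
        - (a * c - b * c) * e3
    ext v
    simp [hv, hα, hβ, hγ]

/-! ### Connecting configurations of the same sign pattern -/

/-- The signs of the forms in the four deformation classes. -/
def formSign : Fin 4 → Fin 10 → ℝ :=
  ![1, ![1, -1, -1, -1, -1, -1, -1, -1, -1, -1], ![1, -1, -1, -1, -1, -1, -1, -1, -1, 1],
    ![1, 1, 1, -1, 1, 1, -1, -1, 1, 1]]

/-- Representatives of the four deformation classes. -/
def standard : Fin 4 → Cfg :=
  ![framed 3 2 1 28 15 7, framed 3 2 1 (-9) (-2) 1, framed 3 2 1 (-6) (-2) 6, framed 3 2 1 4 1 2]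

/-- The set of sixth vectors having the prescribed sign pattern. -/
def region (m : Fin 4) (a b c : ℝ) : Set (ℝ × ℝ × ℝ) :=
  {v | ∀ n, 0 < formSign m n * forms a b c v.1 v.2.1 v.2.2 n}

theorem convex_region (m : Fin 4) (a b c : ℝ) : Convex ℝ (region m a b c) := by
  rintro ⟨x, y, z⟩ hv ⟨x', y', z'⟩ hv' s t hs ht hst n
  have e : forms a b c (s * x + t * x') (s * y + t * y') (s * z + t * z') n
      = s * forms a b c x y z n + t * forms a b c x' y' z' n := by
    fin_cases n <;> simp [forms] <;> ring
  simp only [Prod.smul_mk, Prod.mk_add_mk, smul_eq_mul]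
  rw [e]
  have h1 := hv n
  have h2 := hv' n
  simp only at h1 h2
  rcases hs.eq_or_lt with rfl | hs
  · obtain rfl : t = 1 := by linarith
    linarith
  · nlinarith [mul_pos hs h1, mul_nonneg ht h2.le]

theorem forms_ne_zero {m : Fin 4} {a b c x y z : ℝ} (h : (x, y, z) ∈ region m a b c) (n : Fin 10) :
    forms a b c x y z n ≠ 0 := by
  intro h0
  have := h n
  simp [h0] at this

theorem continuous_framed : Continuous fun v : (ℝ × ℝ × ℝ) × ℝ × ℝ × ℝ =>
    framed v.1.1 v.1.2.1 v.1.2.2 v.2.1 v.2.2.1 v.2.2.2 := by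
  refine continuous_pi fun i => continuous_pi fun l => ?_
  fin_cases i <;> fin_cases l <;> simp [framed] <;> fun_prop

theorem conicForm_ne_zero_of_mem_region {m : Fin 4} (hm : m ≠ 0) {a b c x y z : ℝ} (hc : 0 < c)
    (hbc : c < b) (hab : b < a) (h : (x, y, z) ∈ region m a b c) : conicForm a b c x y z ≠ 0 := by
  have ha : 0 < a := by linarith
  have hb : 0 < b := by linarith
  have hz := h 0
  have hy := h 1
  have hx := h 2
  have hyz := h 3
  have hxz := h 4
  have h14 := h 7
  have h24 := h 8
  have h34 := h 9
  fin_cases m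
  · exact absurd rfl hm
  · simp [forms, formSign] at hz hy hx hyz hxz h14 h24 h34
    have h1 : 0 < (z - y) * (a * z - c * x) * (a - b) :=
      mul_pos (mul_pos (by linarith) (by linarith)) (by linarith)
    have h2 : 0 < z * a * -(x * (b - c) + y * (c - a) + z * (a - b)) :=
      mul_pos (mul_pos (by linarith) ha) (by linarith)
    unfold conicForm
    intro h0
    linarith
  · simp [forms, formSign] at hz hy hx hyz hxz h14 h24 h34
    have h1 : 0 < (b - c) * (z - x) * (a * y - b * x) :=
      mul_pos (mul_pos (by linarith) (by linarith)) (by linarith)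
    have h2 : 0 < -x * b * (x * (b - c) + y * (c - a) + z * (a - b)) :=
      mul_pos (mul_pos (by linarith) hb) (by linarith)
    unfold conicForm
    intro h0
    linarith
  · simp [forms, formSign] at hz hy hx hyz hxz h14 h24 h34
    have h1 : 0 < (z - y) * (a - c) * (b * x - a * y) :=
      mul_pos (mul_pos (by linarith) (by linarith)) (by linarith)
    have h2 : 0 < y * a * (x * (b - c) + y * (c - a) + z * (a - b)) :=
      mul_pos (mul_pos (by linarith) ha) (by linarith)
    unfold conicForm
    intro h0
    linarith

theorem good_of_mem_region {m : Fin 4} (hm : m ≠ 0) {a b c x y z : ℝ} (hc : 0 < c)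
    (hbc : c < b) (hab : b < a) (h : (x, y, z) ∈ region m a b c) : Good (framed a b c x y z) :=
  good_framed hc hbc hab (forms_ne_zero h) (conicForm_ne_zero_of_mem_region hm hc hbc hab h)

/-- A choice of the sixth vector depending continuously on the fifth one. -/
def sixth (m : Fin 4) (a b c : ℝ) : ℝ × ℝ × ℝ :=
  ![(1, 1, 1), (-(a * b + a * c), -((b - c) * b), (b - c) * c),
    (-(2 * a * (a - b)), -(b * (a - b)), 2 * a * (b - c)), (a + c, c, 2 * c)] m

theorem continuous_sixth (m : Fin 4) :
    Continuous fun u : ℝ × ℝ × ℝ => sixth m u.1 u.2.1 u.2.2 := by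
  fin_cases m
  · exact continuous_const
  · change Continuous fun u : ℝ × ℝ × ℝ => (-(u.1 * u.2.1 + u.1 * u.2.2),
      -((u.2.1 - u.2.2) * u.2.1), (u.2.1 - u.2.2) * u.2.2)
    fun_prop
  · change Continuous fun u : ℝ × ℝ × ℝ => (-(2 * u.1 * (u.1 - u.2.1)),
      -(u.2.1 * (u.1 - u.2.1)), 2 * u.1 * (u.2.1 - u.2.2))
    fun_prop
  · change Continuous fun u : ℝ × ℝ × ℝ => (u.1 + u.2.2, u.2.2, 2 * u.2.2)
    fun_prop

theorem sixth_mem_region {m : Fin 4} (hm : m ≠ 0) {a b c : ℝ} (hc : 0 < c) (hbc : c < b)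
    (hab : b < a) : sixth m a b c ∈ region m a b c := by
  obtain ⟨p, rfl⟩ : ∃ p, b = c + p := ⟨b - c, by ring⟩
  obtain ⟨q, rfl⟩ : ∃ q, a = c + p + q := ⟨a - (c + p), by ring⟩
  have hp : 0 < p := by linarith
  have hq : 0 < q := by linarith
  intro n
  fin_cases m
  · exact absurd rfl hm
  all_goals
    fin_cases n <;> simp [forms, formSign, sixth] <;> rw [← sub_pos] <;> ring_nf <;> positivity

theorem convex_chamber : Convex ℝ {u : ℝ × ℝ × ℝ | 0 < u.2.2 ∧ u.2.2 < u.2.1 ∧ u.2.1 < u.1} := by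
  refine (convex_halfSpace_gt (f := fun u : ℝ × ℝ × ℝ => u.2.2) ⟨by simp, by simp⟩ 0).inter
    (Convex.inter ?_ ?_)
  · have := convex_halfSpace_gt (f := fun u : ℝ × ℝ × ℝ => u.2.1 - u.2.2)
      ⟨fun u v => by simp; ring, fun s u => (mul_sub s u.2.1 u.2.2).symm⟩ 0
    simp only [sub_pos] at this
    exact this
  · have := convex_halfSpace_gt (f := fun u : ℝ × ℝ × ℝ => u.1 - u.2.1)
      ⟨fun u v => by simp; ring, fun s u => (mul_sub s u.1 u.2.1).symm⟩ 0
    simp only [sub_pos] at this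
    exact this

theorem rel_standard_of_mem_region {m : Fin 4} (hm : m ≠ 0) {a b c x y z : ℝ} (hc : 0 < c)
    (hbc : c < b) (hab : b < a) (h : (x, y, z) ∈ region m a b c) :
    Rel (framed a b c x y z) (standard m) := by
  have h1 := rel_of_convex (convex_region m a b c)
    (Φ := fun v : ℝ × ℝ × ℝ => framed a b c v.1 v.2.1 v.2.2)
    (continuous_framed.comp (Continuous.prodMk_right (a, b, c)))
    (fun v hv => good_of_mem_region hm hc hbc hab hv) h (sixth_mem_region hm hc hbc hab)
  have h2 := rel_of_convex convex_chamber (x := (a, b, c)) (y := (3, 2, 1))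
    (Φ := fun u : ℝ × ℝ × ℝ => framed u.1 u.2.1 u.2.2 (sixth m u.1 u.2.1 u.2.2).1
      (sixth m u.1 u.2.1 u.2.2).2.1 (sixth m u.1 u.2.1 u.2.2).2.2)
    (continuous_framed.comp (continuous_id.prodMk (continuous_sixth m)))
    (fun u hu => good_of_mem_region hm hu.1 hu.2.1 hu.2.2 (sixth_mem_region hm hu.1 hu.2.1 hu.2.2))
    ⟨hc, hbc, hab⟩ (by norm_num)
  have h3 : standard m = framed 3 2 1 (sixth m 3 2 1).1 (sixth m 3 2 1).2.1
      (sixth m 3 2 1).2.2 := by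
    fin_cases m
    · exact absurd rfl hm
    all_goals simp [standard, sixth]; try norm_num
  rw [h3]
  exact h1.trans h2

/-! ### From sign patterns to regions -/

theorem det3_pos_of_sgn {w : Cfg} (hw : Good w) {i j k : Fin 6} (hij : i ≠ j) (hik : i ≠ k)
    (hjk : j ≠ k) (h : sgn w i j k = false) : 0 < det3 (w i) (w j) (w k) := by
  have h1 := hw.1 i j k hij hik hjk
  have h2 : ¬ det3 (w i) (w j) (w k) < 0 := by simpa [sgn] using h
  exact lt_of_le_of_ne (not_lt.1 h2) h1.symm

/-- An expression in the brackets vanishing exactly when six points lie on a conic. -/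
def bracket (w : Cfg) : ℝ :=
  det3 (w 0) (w 1) (w 2) * det3 (w 0) (w 3) (w 4) * det3 (w 1) (w 3) (w 5) * det3 (w 2) (w 4) (w 5)
    - det3 (w 0) (w 1) (w 3) * det3 (w 0) (w 2) (w 4) * det3 (w 1) (w 2) (w 5)
      * det3 (w 3) (w 4) (w 5)

theorem bracket_framed (a b c x y z : ℝ) :
    bracket (framed a b c x y z) = conicForm a b c x y z := by
  simp [bracket, framed, det3, conicForm]
  ring

/-- The cyclic shift of the six indices. -/
def shift : Equiv.Perm (Fin 6) := Equiv.addRight 1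

theorem bracket_comp_shift (w : Cfg) : bracket (w ∘ shift) = -bracket w := by
  have e : ∀ i : Fin 6, (w ∘ shift) i = w (i + 1) := fun _ => rfl
  simp only [bracket, e]
  simp only [Fin.reduceAdd, det3]
  ring

/-- The pairs of indices in the order in which the forms are listed. -/
def formPair : Fin 10 → Fin 6 × Fin 6 :=
  ![(0, 1), (0, 2), (1, 2), (0, 3), (1, 3), (2, 3), (0, 4), (1, 4), (2, 4), (3, 4)]

theorem det3_framed_formPair (a b c x y z : ℝ) (n : Fin 10) :
    det3 (framed a b c x y z (formPair n).1) (framed a b c x y z (formPair n).2)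
      (framed a b c x y z 5) = forms a b c x y z n := by
  fin_cases n <;> simp [framed, formPair, forms, det3] <;> ring

theorem formPair_lt (n : Fin 10) : (formPair n).1 < (formPair n).2 ∧ (formPair n).2 < 5 := by
  revert n
  decide

theorem formSign_eq (m : Fin 4) (n : Fin 10) : formSign m n =
    if bit (pattern m) (colex (formPair n).1 (formPair n).2 (5 : Fin 6)) then -1 else 1 := by
  have key : ∀ (m : Fin 4) (n : Fin 10),
      (![1, ![1, -1, -1, -1, -1, -1, -1, -1, -1, -1], ![1, -1, -1, -1, -1, -1, -1, -1, -1, 1],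
        ![1, 1, 1, -1, 1, 1, -1, -1, 1, 1]] : Fin 4 → Fin 10 → ℤ) m n =
      if bit (pattern m) (colex (formPair n).1 (formPair n).2 (5 : Fin 6)) then -1 else 1 := by
    decide +kernel
  have h := congrArg (Int.cast : ℤ → ℝ) (key m n)
  rw [apply_ite Int.cast, Int.cast_neg, Int.cast_one] at h
  rw [← h]
  fin_cases m <;> fin_cases n <;> simp [formSign]

theorem exists_framed_mem_region {w : Cfg} {m : Fin 4} (hw : Good w)
    (h : ∀ i j k : Fin 6, i < j → j < k → sgn w i j k = bit (pattern m) (colex i j k)) :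
    ∃ a b c x y z, 0 < c ∧ c < b ∧ b < a ∧ (x, y, z) ∈ region m a b c ∧
      Rel w (framed a b c x y z) ∧ ∃ t, 0 < t ∧ conicForm a b c x y z = t * bracket w := by
  have inner : ∀ m, ∀ i j k : Fin 6, i < j → j < k → k < 5 →
      bit (pattern m) (colex i j k) = false := by decide +kernel
  have pos : ∀ i j k : Fin 6, i < j → j < k → k < 5 → 0 < det3 (w i) (w j) (w k) :=
    fun i j k hij hjk hk => det3_pos_of_sgn hw hij.ne (hij.trans hjk).ne hjk.ne
      (by rw [h i j k hij hjk, inner m i j k hij hjk hk])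
  obtain ⟨a, b, c, x, y, z, hrel, δ, r, hδ, hr, hdet⟩ := exists_rel_framed hw
    (pos 0 1 2 (by decide) (by decide) (by decide)) (pos 0 1 3 (by decide) (by decide) (by decide))
    (pos 0 2 3 (by decide) (by decide) (by decide)) (pos 1 2 3 (by decide) (by decide) (by decide))
  have scale : ∀ i j k, 0 < δ * (r i * r j * r k) := fun i j k =>
    mul_pos hδ (mul_pos (mul_pos (hr i) (hr j)) (hr k))
  have pos' : ∀ i j k : Fin 6, i < j → j < k → k < 5 → 0 < det3 (framed a b c x y z i)
      (framed a b c x y z j) (framed a b c x y z k) := fun i j k hij hjk hk => by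
    rw [hdet]
    exact mul_pos (scale i j k) (pos i j k hij hjk hk)
  refine ⟨a, b, c, x, y, z, ?_, ?_, ?_, fun n => ?_, hrel, ?_⟩
  · simpa [framed, det3] using pos' 0 1 4 (by decide) (by decide) (by decide)
  · have := pos' 0 3 4 (by decide) (by decide) (by decide)
    simp [framed, det3] at this
    linarith
  · have := pos' 2 3 4 (by decide) (by decide) (by decide)
    simp [framed, det3] at this
    linarith
  · obtain ⟨hij, hj⟩ := formPair_lt n
    have hne := hw.1 _ _ 5 hij.ne (hij.trans hj).ne hj.ne
    rw [← det3_framed_formPair, hdet, formSign_eq, ← h _ _ 5 hij hj, mul_left_comm]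
    refine mul_pos (scale _ _ _) ?_
    rcases lt_or_gt_of_ne hne with hd | hd
    · simp [sgn, hd]
    · simp [sgn, hd, hd.not_gt]
  · have ht : (∏ i, r i) ≠ 0 := Finset.prod_ne_zero_iff.2 fun i _ => (hr i).ne'
    refine ⟨δ ^ 4 * (∏ i, r i) ^ 2, by positivity, ?_⟩
    rw [← bracket_framed]
    simp only [bracket, hdet, Fin.prod_univ_six]
    ring

/-! ### The cyclic class -/

/-- A parametrization of the configurations of the cyclic class. -/
def cyclic (a b c X s : ℝ) : Cfg :=
  framed a b c ((a * (a - c) + (a - b) * X) * (a + X))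
    ((a * (a - c) + (a - b) * X) * b + s * (b * (b - c)) * X) ((a * (a - c) + (a - b) * X) * c)

theorem conicForm_cyclic (a b c X s : ℝ) :
    conicForm a b c ((a * (a - c) + (a - b) * X) * (a + X))
      ((a * (a - c) + (a - b) * X) * b + s * (b * (b - c)) * X) ((a * (a - c) + (a - b) * X) * c)
      = c * (a * (a - c) + (a - b) * X) ^ 2 * (b * (b - c)) * X * (s - 1) := by
  unfold conicForm
  ring

theorem good_cyclic {a b c X s : ℝ} (hc : 0 < c) (hbc : c < b) (hab : b < a) (hX : 0 < X)
    (hs : 0 < s) (hs1 : s < 1) : Good (cyclic a b c X s) := by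
  have ha : 0 < a := by linarith
  have hb : 0 < b := by linarith
  have h1 : 0 < a - b := by linarith
  have h2 : 0 < b - c := by linarith
  have h3 : 0 < a - c := by linarith
  have h4 : 0 < 1 - s := by linarith
  have h5 : 0 < a + b - c := by linarith
  have hP : 0 < a * (a - c) + (a - b) * X := by positivity
  refine good_framed hc hbc hab (fun n => ne_of_gt ?_) ?_
  · fin_cases n
    · change 0 < (a * (a - c) + (a - b) * X) * c
      positivity
    · change 0 < (a * (a - c) + (a - b) * X) * b + s * (b * (b - c)) * X
      positivity
    · change 0 < (a * (a - c) + (a - b) * X) * (a + X)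
      positivity
    · have : 0 < (a * (a - c) + (a - b) * X) * (b - c) + s * (b * (b - c)) * X := by positivity
      simp [forms]
      linarith
    · have : 0 < (a * (a - c) + (a - b) * X) * (a - c + X) := by positivity
      simp [forms]
      linarith
    · have : 0 < (a * (a - c) + (a - b) * X) * (a - b)
          + X * ((a - b) * (a + b - c) + (1 - s) * (b * (b - c)) + (a - b) * X) := by positivity
      simp [forms]
      linarith
    · have : 0 < c * s * (b * (b - c)) * X := by positivity
      simp [forms]
      linarith
    · have : 0 < (a * (a - c) + (a - b) * X) * (c * X) := by positivity
      simp [forms]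
      linarith
    · have : 0 < X * (a * b * (a - b) + a * (b * (b - c)) * (1 - s) + b * (a - b) * X) := by
        positivity
      simp [forms]
      linarith
    · have : 0 < X * ((1 - s) * (b * (b - c)) * (a - c) + (a - b) * (a - c) * (b - c)
          + (a - b) * X * (b - c)) := by positivity
      simp [forms]
      linarith
  · rw [conicForm_cyclic]
    have : 0 < c * (a * (a - c) + (a - b) * X) ^ 2 * (b * (b - c)) * X * (1 - s) := by positivity
    intro h0
    linarith

theorem continuous_cyclic : Continuous fun v : (ℝ × ℝ × ℝ) × ℝ × ℝ =>
    cyclic v.1.1 v.1.2.1 v.1.2.2 v.2.1 v.2.2 := by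
  have h := continuous_framed.comp (continuous_fst.prodMk (g := fun v : (ℝ × ℝ × ℝ) × ℝ × ℝ =>
    ((v.1.1 * (v.1.1 - v.1.2.2) + (v.1.1 - v.1.2.1) * v.2.1) * (v.1.1 + v.2.1),
      (v.1.1 * (v.1.1 - v.1.2.2) + (v.1.1 - v.1.2.1) * v.2.1) * v.1.2.1
        + v.2.2 * (v.1.2.1 * (v.1.2.1 - v.1.2.2)) * v.2.1,
      (v.1.1 * (v.1.1 - v.1.2.2) + (v.1.1 - v.1.2.1) * v.2.1) * v.1.2.2)) (by fun_prop))
  exact h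

theorem rel_cyclic_standard {a b c X s : ℝ} (hc : 0 < c) (hbc : c < b) (hab : b < a) (hX : 0 < X)
    (hs : 0 < s) (hs1 : s < 1) : Rel (cyclic a b c X s) (standard 0) := by
  have h := rel_of_convex
    (convex_chamber.prod ((convex_Ioi (0 : ℝ)).prod (convex_Ioo (0 : ℝ) 1))) continuous_cyclic
    (fun v hv => good_cyclic hv.1.1 hv.1.2.1 hv.1.2.2 hv.2.1 hv.2.2.1 hv.2.2.2)
    (x := ((a, b, c), X, s)) (y := ((3, 2, 1), 1, 1 / 2)) ⟨⟨hc, hbc, hab⟩, hX, hs, hs1⟩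
    ⟨by norm_num, by norm_num, by norm_num⟩
  have e : standard 0 = cyclic 3 2 1 1 (1 / 2) := by
    simp [standard, cyclic]
    norm_num
  rw [e]
  exact h

theorem rel_standard_of_conicForm_neg {a b c x y z : ℝ} (hc : 0 < c) (hbc : c < b) (hab : b < a)
    (h : (x, y, z) ∈ region 0 a b c) (hC : conicForm a b c x y z < 0) :
    Rel (framed a b c x y z) (standard 0) := by
  have ha : 0 < a := by linarith
  have hb : 0 < b := by linarith
  have h1 : 0 < a - b := by linarith
  have h2 : 0 < b - c := by linarith
  have h3 : 0 < a - c := by linarith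
  have hz : 0 < z := by simpa [forms, formSign] using h 0
  have hcy : 0 < c * y - b * z := by simpa [forms, formSign] using h 6
  have hcx : 0 < c * x - a * z := by simpa [forms, formSign] using h 7
  have hX : 0 < (c * x - a * z) / z := by positivity
  have hY : 0 < (c * y - b * z) / z := by positivity
  have hxz : c * x = z * (a + (c * x - a * z) / z) := by field_simp; ring
  have hyz : c * y = z * (b + (c * y - b * z) / z) := by field_simp; ring
  generalize (c * x - a * z) / z = X at hX hxz
  generalize (c * y - b * z) / z = Y at hY hyz
  have hP : 0 < a * (a - c) + (a - b) * X := by positivity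
  obtain ⟨s, hs⟩ : ∃ s, s = Y * (a * (a - c) + (a - b) * X) / (b * (b - c) * X) := ⟨_, rfl⟩
  have hs0 : 0 < s := by rw [hs]; positivity
  have hsY : s * (b * (b - c)) * X = Y * (a * (a - c) + (a - b) * X) := by
    rw [hs]
    field_simp
  have hx : x = z / c * (a + X) := by field_simp; linarith
  have hy : y = z / c * (b + Y) := by field_simp; linarith
  obtain ⟨k, hk, hk0⟩ : ∃ k, k = (a * (a - c) + (a - b) * X) * (c / z) ∧ 0 < k :=
    ⟨_, rfl, by positivity⟩
  have kx : k * x = (a * (a - c) + (a - b) * X) * (a + X) := by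
    rw [hk, hx]; field_simp
  have ky : k * y = (a * (a - c) + (a - b) * X) * b + s * (b * (b - c)) * X := by
    rw [hsY, hk, hy]; field_simp
  have kz : k * z = (a * (a - c) + (a - b) * X) * c := by
    rw [hk]; field_simp
  have hs1 : s < 1 := by
    have e := conicForm_cyclic a b c X s
    rw [← kx, ← ky, ← kz] at e
    have e' : conicForm a b c (k * x) (k * y) (k * z) = k ^ 2 * conicForm a b c x y z := by
      unfold conicForm
      ring
    rw [e'] at e
    by_contra! hs1
    have h4 : 0 ≤ s - 1 := by linarith
    have h5 : 0 ≤ c * (a * (a - c) + (a - b) * X) ^ 2 * (b * (b - c)) * X * (s - 1) := by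
      positivity
    have h6 : k ^ 2 * conicForm a b c x y z < 0 := mul_neg_of_pos_of_neg (by positivity) hC
    linarith
  have hG : Good (framed a b c x y z) := good_framed hc hbc hab (forms_ne_zero h) hC.ne
  have hr := rel_smul hG (c := fun i => if i = 5 then k else 1) fun i => by
    split_ifs
    exacts [hk0.ne', one_ne_zero]
  have e : (fun i => (if i = 5 then k else 1 : ℝ) • framed a b c x y z i) = cyclic a b c X s := by
    unfold cyclic
    rw [← kx, ← ky, ← kz]
    funext i l
    fin_cases i <;> fin_cases l <;> simp [framed]
  rw [e] at hr
  exact hr.trans (rel_cyclic_standard hc hbc hab hX hs0 hs1)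

theorem rel_standard_of_pos {w : Cfg} (hw : Good w)
    (h : ∀ i j k : Fin 6, i < j → j < k → sgn w i j k = bit (pattern 0) (colex i j k))
    (hC : bracket w < 0) : Rel w (standard 0) := by
  obtain ⟨a, b, c, x, y, z, hc, hbc, hab, hv, hrel, t, ht, e⟩ := exists_framed_mem_region hw h
  exact hrel.trans (rel_standard_of_conicForm_neg hc hbc hab hv
    (by rw [e]; exact mul_neg_of_pos_of_neg ht hC))

theorem sgn_comp_shift {w : Cfg} (h : ∀ i j k : Fin 6, i < j → j < k → sgn w i j k = false)
    (i j k : Fin 6) (hij : i < j) (hjk : j < k) : sgn (w ∘ shift) i j k = false := by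
  have e : sgn (w ∘ shift) i j k = sgn w (i + 1) (j + 1) (k + 1) := rfl
  have e' : sgn w (i + 1) (j + 1) (k + 1) = sgn w (k + 1) (i + 1) (j + 1) := by
    simp only [sgn, det3]
    congr 2
    ring
  have key : ∀ i j k : Fin 6, i < j → j < k → (i + 1 < j + 1 ∧ j + 1 < k + 1) ∨
      (k + 1 < i + 1 ∧ i + 1 < j + 1) := by decide
  rw [e]
  rcases key i j k hij hjk with h' | h'
  · exact h _ _ _ h'.1 h'.2
  · rw [e']
    exact h _ _ _ h'.1 h'.2

theorem exists_rel_standard {w : Cfg} (hw : Good w) : ∃ m, Rel w (standard m) := by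
  obtain ⟨m, w', hrel, h⟩ := exists_rel_pattern hw
  refine ⟨m, hrel.trans ?_⟩
  obtain ⟨a, b, c, x, y, z, hc, hbc, hab, hv, hrel', t, ht, e⟩ :=
    exists_framed_mem_region hrel.2.1 h
  by_cases hm : m = 0
  · subst hm
    have hzero : ∀ i j k : Fin 6, bit (pattern 0) (colex i j k) = false := by decide +kernel
    have hC := hrel'.2.1.conicForm_ne_zero (hc.trans hbc) (hbc.trans hab)
    rw [e] at hC
    rcases lt_or_gt_of_ne (right_ne_zero_of_mul hC) with hC | hC
    · exact rel_standard_of_pos hrel.2.1 h hC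
    · refine (rel_perm hrel.2.1 shift).trans (rel_standard_of_pos (hrel.2.1.perm shift)
        (fun i j k hij hjk => ?_) (by rw [bracket_comp_shift]; linarith))
      rw [hzero]
      exact sgn_comp_shift (fun i j k hij hjk => by rw [h i j k hij hjk, hzero]) i j k hij hjk
  · exact hrel'.trans (rel_standard_of_mem_region hm hc hbc hab hv)

theorem good_standard (m : Fin 4) : Good (standard m) := by
  by_cases hm : m = 0
  · subst hm
    exact (rel_cyclic_standard one_pos one_lt_two (by norm_num : (2 : ℝ) < 3) one_pos
      (by norm_num : (0 : ℝ) < 1 / 2) (by norm_num)).2.1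
  · exact (rel_standard_of_mem_region hm one_pos one_lt_two (by norm_num : (2 : ℝ) < 3)
      (sixth_mem_region hm one_pos one_lt_two (by norm_num))).2.1

theorem exists_eq_cls (p : ZerothHomotopy (UnlabeledSpace 6)) :
    ∃ m, p = cls (standard m) (good_standard m) := by
  induction p using Quotient.inductionOn with
  | _ p =>
    induction p using Quot.inductionOn with
    | _ f =>
      have hf := (typicalCfg_iff f.1).1 f.2
      obtain ⟨m, _, _, h⟩ := exists_rel_standard hf
      refine ⟨m, Eq.trans ?_ h⟩
      have : f = toT _ hf := Subtype.ext (funext fun i => (Projectivization.mk_rep (f.1 i)).symm)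
      rw [cls, ← this]

/-! ### An integral invariant of deformation classes -/

/-- The orientation of a triple. -/
def orient {R : Type*} [CommRing R] [LinearOrder R] (w : Fin 6 → Fin 3 → R) (i j k : Fin 6) : ℤ :=
  SignType.sign (det3 (w i) (w j) (w k))

/-- The product of the orientations of all triples containing a given pair. -/
def edgeSign (χ : Fin 6 → Fin 6 → Fin 6 → ℤ) (i j : Fin 6) : ℤ :=
  ∏ k, if k = i ∨ k = j then 1 else χ i j k

/-- The sum of the squares of the signed numbers of triangles at the ordered pairs. -/
def energy (χ : Fin 6 → Fin 6 → Fin 6 → ℤ) : ℤ :=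
  ∑ i, ∑ j, (∑ k, edgeSign χ i j * edgeSign χ j k * edgeSign χ k i) ^ 2

theorem edgeSign_perm (χ : Fin 6 → Fin 6 → Fin 6 → ℤ) (σ : Equiv.Perm (Fin 6)) (i j : Fin 6) :
    edgeSign (fun i j k => χ (σ i) (σ j) (σ k)) i j = edgeSign χ (σ i) (σ j) := by
  rw [edgeSign, edgeSign,
    ← Equiv.prod_comp σ fun k => if k = σ i ∨ k = σ j then 1 else χ (σ i) (σ j) k]
  simp only [EmbeddingLike.apply_eq_iff_eq]

theorem energy_perm (χ : Fin 6 → Fin 6 → Fin 6 → ℤ) (σ : Equiv.Perm (Fin 6)) :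
    energy (fun i j k => χ (σ i) (σ j) (σ k)) = energy χ := by
  simp only [energy, edgeSign_perm]
  rw [← Equiv.sum_comp σ fun i =>
    ∑ j, (∑ k, edgeSign χ i j * edgeSign χ j k * edgeSign χ k i) ^ 2]
  refine Finset.sum_congr rfl fun i _ => ?_
  rw [← Equiv.sum_comp σ fun j =>
    (∑ k, edgeSign χ (σ i) j * edgeSign χ j k * edgeSign χ k (σ i)) ^ 2]
  refine Finset.sum_congr rfl fun j _ => ?_
  rw [← Equiv.sum_comp σ fun k =>
    edgeSign χ (σ i) (σ j) * edgeSign χ (σ j) k * edgeSign χ k (σ i)]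

theorem edgeSign_rescale {χ : Fin 6 → Fin 6 → Fin 6 → ℤ} (hχ : ∀ i k, χ i i k = 0)
    {ε : Fin 6 → ℤ} (hε : ∀ i, ε i * ε i = 1) (i j : Fin 6) :
    edgeSign (fun i j k => ε i * ε j * ε k * χ i j k) i j
      = (∏ k, ε k) * (ε i * ε j) * edgeSign χ i j := by
  rcases eq_or_ne i j with rfl | hij
  · obtain ⟨k, -, hik, -⟩ := exists_distinct_pair i
    have h0 : ∀ χ' : Fin 6 → Fin 6 → Fin 6 → ℤ, (∀ i k, χ' i i k = 0) → edgeSign χ' i i = 0 :=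
      fun χ' h => Finset.prod_eq_zero (Finset.mem_univ k) (by simp [hik.symm, h])
    rw [h0 _ hχ, h0 _ fun i k => by simp [hχ], mul_zero]
  · have h1 : edgeSign (fun i j k => ε i * ε j * ε k * χ i j k) i j =
        (∏ k, if k = i ∨ k = j then 1 else ε i * ε j * ε k) * edgeSign χ i j := by
      rw [edgeSign, edgeSign, ← Finset.prod_mul_distrib]
      refine Finset.prod_congr rfl fun k _ => ?_
      split_ifs <;> simp
    have h2 : (∏ k, if k = i ∨ k = j then ε i * ε j * ε k else 1) = ε i * ε j := by
      have : ∀ k, (k = i ∨ k = j) ↔ k ∈ ({i, j} : Finset (Fin 6)) := by simp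
      simp only [this, Finset.prod_ite_mem, Finset.univ_inter]
      rw [Finset.prod_pair hij]
      linear_combination (ε i * ε j * ε j * ε j) * hε i + ε i * ε j * hε j
    have h3 : (∏ k, if k = i ∨ k = j then 1 else ε i * ε j * ε k) *
        (∏ k, if k = i ∨ k = j then ε i * ε j * ε k else 1) = ∏ k, ε k := by
      rw [← Finset.prod_mul_distrib]
      have : ∀ k, ((if k = i ∨ k = j then 1 else ε i * ε j * ε k) *
          if k = i ∨ k = j then ε i * ε j * ε k else 1) = ε i * ε j * ε k := by
        intro k
        split_ifs <;> simp
      simp only [this, Finset.prod_mul_distrib, Finset.prod_const, Finset.card_univ,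
        Fintype.card_fin]
      have e : (ε i * ε j) * (ε i * ε j) = 1 := by
        linear_combination (ε j * ε j) * hε i + hε j
      have : ε i ^ 6 * ε j ^ 6 = 1 := by
        calc ε i ^ 6 * ε j ^ 6 = ((ε i * ε j) * (ε i * ε j)) ^ 3 := by ring
          _ = 1 := by rw [e, one_pow]
      rw [this, one_mul]
    rw [h1, ← h3, h2]
    have e : (ε i * ε j) * (ε i * ε j) = 1 := by
      linear_combination (ε j * ε j) * hε i + hε j
    rw [mul_assoc (∏ k, _), e, mul_one]

theorem energy_rescale {χ : Fin 6 → Fin 6 → Fin 6 → ℤ} (hχ : ∀ i k, χ i i k = 0)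
    {ε : Fin 6 → ℤ} (hε : ∀ i, ε i * ε i = 1) :
    energy (fun i j k => ε i * ε j * ε k * χ i j k) = energy χ := by
  simp only [energy, edgeSign_rescale hχ hε]
  refine Finset.sum_congr rfl fun i _ => Finset.sum_congr rfl fun j _ => ?_
  have h : (∏ k, ε k) * (∏ k, ε k) = 1 := by
    rw [← Finset.prod_mul_distrib]
    simp [hε]
  have : ∀ k, (∏ k, ε k) * (ε i * ε j) * edgeSign χ i j *
      ((∏ k, ε k) * (ε j * ε k) * edgeSign χ j k) *
      ((∏ k, ε k) * (ε k * ε i) * edgeSign χ k i)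
      = (∏ k, ε k) * (edgeSign χ i j * edgeSign χ j k * edgeSign χ k i) := by
    intro k
    generalize (∏ k, ε k) = p at h ⊢
    calc _ = (p * p) * (ε i * ε i) * (ε j * ε j) * (ε k * ε k) *
        (p * (edgeSign χ i j * edgeSign χ j k * edgeSign χ k i)) := by ring
      _ = _ := by simp only [h, hε, one_mul]
  simp only [this]
  rw [← Finset.mul_sum, mul_pow, pow_two (∏ k, ε k), h, one_mul]

theorem orient_self (w : Cfg) (i k : Fin 6) : orient w i i k = 0 := by
  have : det3 (w i) (w i) (w k) = 0 := by
    unfold det3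
    ring
  simp [orient, this]

theorem energy_smul (w : Cfg) {c : Fin 6 → ℝ} (hc : ∀ i, c i ≠ 0) :
    energy (orient fun i => c i • w i) = energy (orient w) := by
  rw [← energy_rescale (orient_self w) (ε := fun i => (SignType.sign (c i) : ℤ))]
  · congr 1
    funext i j k
    have : det3 (c i • w i) (c j • w j) (c k • w k)
        = c i * c j * c k * det3 (w i) (w j) (w k) := by
      simp only [det3, Pi.smul_apply, smul_eq_mul]
      ring
    simp only [orient, this, sign_mul, SignType.coe_mul]
  · intro i
    rcases lt_or_gt_of_ne (hc i) with h | h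
    · simp [sign_neg h]
    · simp [sign_pos h]

theorem continuous_energy {X : Type*} [TopologicalSpace X] {γ : X → Cfg} (hγ : Continuous γ)
    (h : ∀ x, Good (γ x)) : Continuous fun x => energy (orient (γ x)) := by
  have hi : ∀ i, Continuous fun x => γ x i := fun i => (continuous_apply i).comp hγ
  have ho : ∀ i j k, i ≠ j → i ≠ k → j ≠ k → Continuous fun x => orient (γ x) i j k := by
    intro i j k hij hik hjk
    refine (continuous_of_discreteTopology (f := fun s : SignType => (s : ℤ))).comp
      (continuous_iff_continuousAt.2 fun x => ?_)
    refine (continuousAt_sign_of_ne_zero ((h x).1 i j k hij hik hjk)).comp (f := fun x =>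
      det3 (γ x i) (γ x j) (γ x k)) ?_
    have hl : ∀ i l, Continuous fun x => γ x i l := fun i l => (continuous_apply l).comp (hi i)
    unfold det3
    have h1 := hl i
    have h2 := hl j
    have h3 := hl k
    fun_prop
  have he : ∀ i j, Continuous fun x => edgeSign (orient (γ x)) i j := by
    intro i j
    refine continuous_finsetProd _ fun k _ => ?_
    by_cases hk : k = i ∨ k = j
    · simp only [hk, if_true]
      exact continuous_const
    · simp only [hk, if_false]
      rw [not_or] at hk
      rcases eq_or_ne i j with rfl | hij
      · simp only [orient_self]
        exact continuous_const
      · exact ho i j k hij (Ne.symm hk.1) (Ne.symm hk.2)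
  unfold energy
  fun_prop

/-- The invariant of a labeled configuration. -/
def labeledEnergy (f : TSpace 6) : ℤ := energy (orient fun i => (f.1 i).rep)

theorem continuous_labeledEnergy : Continuous labeledEnergy := by
  have hq : IsOpenQuotientMap
      (Pi.map fun _ => proj : (Fin 6 → {v : Fin 3 → ℝ // v ≠ 0}) → Fin 6 → RP2) :=
    IsOpenQuotientMap.piMap fun _ => isOpenQuotientMap_proj
  have hq' := (hq.restrictPreimage {f | TypicalCfg f}).isQuotientMap
  refine hq'.continuous_iff.2 ?_
  have hG : ∀ v : (Pi.map fun _ => proj : (Fin 6 → {v : Fin 3 → ℝ // v ≠ 0}) → Fin 6 → RP2) ⁻¹'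
      {f | TypicalCfg f}, Good fun i => (v.1 i).1 := fun v =>
    (typicalCfg_toPts_iff fun i => (v.1 i).2).1 v.2
  refine (continuous_energy (γ := fun v i => (v.1 i).1)
    (continuous_pi fun i => continuous_subtype_val.comp
      ((continuous_apply i).comp continuous_subtype_val)) hG).congr fun v => ?_
  choose c hc e using fun i => exists_rep_eq_smul (v.1 i).1 (v.1 i).2
  rw [← energy_smul _ hc]
  exact congrArg (fun w : Cfg => energy (orient w)) (funext fun i => (e i).symm)

/-- The invariant of an unlabeled configuration. -/
def unlabeledEnergy : UnlabeledSpace 6 → ℤ :=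
  Quot.lift labeledEnergy fun f g ⟨σ, h⟩ => by
    unfold labeledEnergy
    rw [h]
    exact energy_perm (orient fun i => (g.1 i).rep) σ

theorem continuous_unlabeledEnergy : Continuous unlabeledEnergy :=
  continuous_quot_lift _ continuous_labeledEnergy

theorem energy_eq_of_rel {v w : Cfg} (h : Rel v w) :
    energy (orient v) = energy (orient w) := by
  have key : ∀ {v : Cfg} (hv : Good v),
      unlabeledEnergy (Quot.mk _ (toT v hv)) = energy (orient v) := by
    intro v hv
    choose c hc e using fun i => exists_rep_eq_smul (v i) (hv.ne_zero i)
    rw [← energy_smul _ hc]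
    exact congrArg (fun w : Cfg => energy (orient w)) (funext e)
  obtain ⟨hv, hw, h⟩ := h
  obtain ⟨γ⟩ := Quotient.exact h
  rw [← key hv, ← key hw]
  have := PreconnectedSpace.constant (Y := ℤ) inferInstance
    (continuous_unlabeledEnergy.comp γ.continuous) (x := 0) (y := 1)
  simpa using this

/-- The representatives, with integral coordinates. -/
def standardInt : Fin 4 → Fin 6 → Fin 3 → ℤ := fun m =>
  ![![1, 0, 0], ![0, 1, 0], ![0, 0, 1], ![1, -1, 1], ![3, -2, 1],
    ![![28, -15, 7], ![-9, 2, 1], ![-6, 2, 6], ![4, -1, 2]] m]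

theorem standard_eq_intCast (m : Fin 4) (i : Fin 6) (l : Fin 3) :
    standard m i l = (standardInt m i l : ℝ) := by
  fin_cases m <;> fin_cases i <;> fin_cases l <;> simp [standard, standardInt, framed]

theorem orient_standard (m : Fin 4) : orient (standard m) = orient (standardInt m) := by
  funext i j k
  have : det3 (standard m i) (standard m j) (standard m k)
      = (det3 (standardInt m i) (standardInt m j) (standardInt m k) : ℤ) := by
    simp only [det3, standard_eq_intCast]
    push_cast
    ring
  rw [orient, orient, this, sign_intCast]

theorem energy_standardInt_injective :
    Function.Injective fun m => energy (orient (standardInt m)) := by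
  have : ∀ m, energy (orient (standardInt m)) = ![480, 192, 96, 0] m := by decide +kernel
  simp only [this]
  decide

theorem cls_standard_bijective :
    Function.Bijective fun m => cls (standard m) (good_standard m) := by
  refine ⟨fun m m' h => energy_standardInt_injective ?_, fun p => ?_⟩
  · have := energy_eq_of_rel ⟨good_standard m, good_standard m', h⟩
    simpa only [orient_standard] using this
  · obtain ⟨m, h⟩ := exists_eq_cls p
    exact ⟨m, h.symm⟩

end SixPoints

/-- Typical 6-configurations in the real projective plane split into exactly 4
Q-deformation classes: the space of unlabeled typical 6-configurations has exactly 4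
path components. -/
theorem four_q_deformation_classes :
    Nat.card (ZerothHomotopy (UnlabeledSpace 6)) = 4 := by
  rw [← Nat.card_eq_of_bijective _ SixPoints.cls_standard_bijective, Nat.card_eq_fintype_card,
    Fintype.card_fin]

end
end

section
/- Let P be a typical 6-configuration and let p, q ∈ P be adjacent in P (joined by an edge of the adjacency graph Γ_P). Then exactly one of p and q is dominant and the other is subdominant. -/
open scoped LinearAlgebra.Projectivization
open Projectivization

noncomputable section

/-- Two points `f i`, `f j` of a configuration are adjacent (joined by an edge of the
adjacency graph): at least one of the two open arcs into which they divide the projective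
line through them is disjoint from every line through two of the remaining points. -/
def Adjacent {n : ℕ} (f : Fin n → RP2) (i j : Fin n) : Prop :=
  ∃ L : Set RP2, IsProjLine L ∧ f i ∈ L ∧ f j ∈ L ∧
    ∃ x ∈ L \ {f i, f j},
      ∀ k l : Fin n, k ≠ i → k ≠ j → l ≠ i → l ≠ j → k ≠ l →
        ∀ M : Set RP2, IsProjLine M → f k ∈ M → f l ∈ M →
          connectedComponentIn (L \ {f i, f j}) x ∩ M = ∅

/-! ### Points and lines of the projective plane -/

lemma exists_rep_mk_eq_smul (y : Fin 3 → ℝ) (hy : y ≠ 0) :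
    ∃ a : ℝ, a ≠ 0 ∧ (mk ℝ y hy).rep = a • y := by
  obtain ⟨a, ha⟩ := exists_smul_eq_mk_rep ℝ y hy
  exact ⟨a, a.ne_zero, ha.symm⟩

lemma eq_of_rep_eq_smul {p q : RP2} {a : ℝ} (h : p.rep = a • q.rep) : p = q := by
  rw [← mk_rep p, ← mk_rep q, mk_eq_mk_iff']
  exact ⟨a, h.symm⟩

lemma linearIndependent_rep_pair {p q : RP2} (h : p ≠ q) :
    LinearIndependent ℝ ![p.rep, q.rep] := by
  rw [LinearIndependent.pair_iff' p.rep_nonzero]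
  intro a ha
  exact h (eq_of_rep_eq_smul ha.symm).symm

lemma eq_span_pair_of_finrank_eq_two {W : Submodule ℝ (Fin 3 → ℝ)}
    (hW : Module.finrank ℝ W = 2) {u v : Fin 3 → ℝ} (hu : u ∈ W) (hv : v ∈ W)
    (h : LinearIndependent ℝ ![u, v]) : W = Submodule.span ℝ {u, v} := by
  symm
  apply Submodule.eq_of_le_of_finrank_eq
  · rw [Submodule.span_le]
    rintro x (rfl | rfl) <;> assumption
  · have := finrank_span_eq_card h
    rw [Matrix.range_cons_cons_empty, Fintype.card_fin] at this
    rw [this, hW]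

lemma exists_linearIndependent_pair_of_finrank_eq_two {W : Submodule ℝ (Fin 3 → ℝ)}
    (hW : Module.finrank ℝ W = 2) {w : Fin 3 → ℝ} (hw : w ≠ 0) :
    ∃ v ∈ W, LinearIndependent ℝ ![w, v] := by
  by_contra! h
  have hle : W ≤ Submodule.span ℝ {w} := by
    intro v hv
    have := h v hv
    rw [LinearIndependent.pair_iff' hw] at this
    push Not at this
    exact Submodule.mem_span_singleton.2 this
  have := Submodule.finrank_mono hle
  rw [hW, finrank_span_singleton hw] at this
  omega

/-! ### Points inside and outside a conic -/

lemma insideConic_of_polar_sq_ge {Q : QuadraticForm ℝ (Fin 3 → ℝ)} {p : RP2}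
    (hp : Q p.rep ≠ 0)
    (h : ∀ v, 0 ≤ QuadraticMap.polar Q p.rep v ^ 2 - 4 * Q p.rep * Q v) :
    InsideConic Q p := by
  rintro L ⟨W, hW, rfl⟩ hpW
  obtain ⟨v, hv, hli⟩ := exists_linearIndependent_pair_of_finrank_eq_two hW p.rep_nonzero
  obtain ⟨s, hs⟩ := exists_quadratic_eq_zero (a := Q p.rep)
    (b := QuadraticMap.polar Q p.rep v) (c := Q v) hp
    ⟨_, (Real.mul_self_sqrt (h v)).symm⟩
  have hne : s • p.rep + v ≠ 0 := by
    intro h0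
    rw [LinearIndependent.pair_iff] at hli
    simpa using hli s 1 (by simpa using h0)
  obtain ⟨a, -, ha⟩ := exists_rep_mk_eq_smul _ hne
  refine ⟨mk ℝ _ hne, ?_, ?_⟩
  · change _ ∈ W
    rw [ha]
    exact W.smul_mem _ (W.add_mem (W.smul_mem _ hpW) hv)
  · change Q _ = 0
    rw [ha, QuadraticMap.map_smul, QuadraticMap.map_add Q, QuadraticMap.map_smul,
      QuadraticMap.polar_smul_left]
    simp only [smul_eq_mul]
    linear_combination (a * a) * hs

lemma outsideConic_of_polar_sq_lt {Q : QuadraticForm ℝ (Fin 3 → ℝ)} {p : RP2} {v : Fin 3 → ℝ}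
    (h : QuadraticMap.polar Q p.rep v ^ 2 - 4 * Q p.rep * Q v < 0) :
    OutsideConic Q p := by
  have hli : LinearIndependent ℝ ![p.rep, v] := by
    rw [LinearIndependent.pair_iff' p.rep_nonzero]
    rintro a rfl
    rw [QuadraticMap.polar_smul_right, QuadraticMap.polar_self, QuadraticMap.map_smul] at h
    simp only [smul_eq_mul, nsmul_eq_mul, Nat.cast_ofNat] at h
    nlinarith
  have hQp : Q p.rep ≠ 0 := by
    intro h0
    rw [h0] at h
    nlinarith [sq_nonneg (QuadraticMap.polar Q p.rep v)]
  refine ⟨_, ⟨Submodule.span ℝ {p.rep, v}, ?_, rfl⟩, ?_, ?_⟩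
  · have := finrank_span_eq_card hli
    rwa [Matrix.range_cons_cons_empty, Fintype.card_fin] at this
  · exact Submodule.subset_span (by simp)
  · rw [Set.eq_empty_iff_forall_notMem]
    rintro r ⟨hr, hQr⟩
    obtain ⟨s, t, hst⟩ := Submodule.mem_span_pair.1 hr
    change Q r.rep = 0 at hQr
    have hr0 := r.rep_nonzero
    rw [← hst] at hQr hr0
    rw [QuadraticMap.map_add Q, QuadraticMap.map_smul, QuadraticMap.map_smul,
      QuadraticMap.polar_smul_left, QuadraticMap.polar_smul_right] at hQr
    simp only [smul_eq_mul] at hQr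
    set P := QuadraticMap.polar Q p.rep v
    have key : (2 * s * Q p.rep + t * P) ^ 2 = t ^ 2 * (P ^ 2 - 4 * Q p.rep * Q v) := by
      linear_combination 4 * Q p.rep * hQr
    have ht : t = 0 := by
      by_contra ht
      have := mul_neg_of_pos_of_neg (sq_pos_of_ne_zero ht) h
      nlinarith [sq_nonneg (2 * s * Q p.rep + t * P)]
    subst ht
    have hs : s = 0 := by
      by_contra hs
      simp [hs, hQp] at hQr
    simp [hs] at hr0

lemma OutsideConic.not_insideConic {Q : QuadraticForm ℝ (Fin 3 → ℝ)} {p : RP2}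
    (h : OutsideConic Q p) : ¬ InsideConic Q p := by
  obtain ⟨L, hL, hp, hemp⟩ := h
  intro hin
  have := hin L hL hp
  simp [hemp] at this

/-! ### Adjacent points -/

lemma SimpleCfg.dual_ne_zero {n : ℕ} {f : Fin n → RP2} (hf : SimpleCfg f) {k l m : Fin n}
    (hkl : k ≠ l) (hkm : k ≠ m) (hlm : l ≠ m) {φ : (Fin 3 → ℝ) →ₗ[ℝ] ℝ} (hφ : φ ≠ 0)
    (hk : φ (f k).rep = 0) (hl : φ (f l).rep = 0) : φ (f m).rep ≠ 0 := by
  intro hm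
  have hli := not_not.1 (hf.2 k l m hkl hkm hlm)
  have hspan := hli.span_eq_top_of_card_eq_finrank (by simp)
  refine hφ (LinearMap.ext_on_range hspan fun x => ?_)
  fin_cases x <;> simpa

lemma isProjLine_dual {φ : (Fin 3 → ℝ) →ₗ[ℝ] ℝ} (hφ : φ ≠ 0) :
    IsProjLine {p : RP2 | φ p.rep = 0} := by
  refine ⟨LinearMap.ker φ, ?_, by simp⟩
  have h1 := LinearMap.finrank_range_add_finrank_ker φ
  have h2 : Module.finrank ℝ (LinearMap.range φ) = 1 := by
    rw [LinearMap.range_eq_top.2 (LinearMap.surjective hφ)]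
    simp
  simp only [Module.finrank_fin_fun] at h1
  omega

lemma mk_mem_connectedComponentIn {W : Submodule ℝ (Fin 3 → ℝ)} {p q x : RP2} {α β s t : ℝ}
    (hp : p.rep ∈ W) (hq : q.rep ∈ W) (hpq : p ≠ q) (hα : α ≠ 0) (hβ : β ≠ 0)
    (hx : x.rep = α • p.rep + β • q.rep) (hs : 0 < s) (ht : 0 < t)
    (hy : (s * α) • p.rep + (t * β) • q.rep ≠ 0) :
    mk ℝ _ hy ∈ connectedComponentIn ({r : RP2 | r.rep ∈ W} \ {p, q}) x := by
  have hli := LinearIndependent.pair_iff.1 (linearIndependent_rep_pair hpq)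
  let S : Set (ℝ × ℝ) := Set.Ioi 0 ×ˢ Set.Ioi 0
  have hS : IsPreconnected S := ((convex_Ioi 0).prod (convex_Ioi 0)).isPreconnected
  have : PreconnectedSpace S := Subtype.preconnectedSpace hS
  let y : S → Fin 3 → ℝ := fun σ => (σ.1.1 * α) • p.rep + (σ.1.2 * β) • q.rep
  have hy0 : ∀ σ, y σ ≠ 0 := by
    intro σ h0
    have h1 := (hli _ _ h0).1
    have h2 : (0 : ℝ) < σ.1.1 := σ.2.1
    simp [hα, h2.ne'] at h1
  let g : S → RP2 := fun σ => mk ℝ (y σ) (hy0 σ)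
  have hg : Continuous g := by
    have h1 : Continuous fun σ => (⟨y σ, hy0 σ⟩ : {v : Fin 3 → ℝ // v ≠ 0}) := by
      apply Continuous.subtype_mk
      fun_prop
    exact continuous_quotient_mk'.comp h1
  refine (isPreconnected_range hg).subset_connectedComponentIn ?_ ?_ ⟨⟨(s, t), hs, ht⟩, rfl⟩
  · refine ⟨⟨(1, 1), by simp [S]⟩, ?_⟩
    rw [← mk_rep x]
    simp [g, y, hx]
  · rintro _ ⟨σ, rfl⟩
    have h1 : (0 : ℝ) < σ.1.1 := σ.2.1
    have h2 : (0 : ℝ) < σ.1.2 := σ.2.2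
    obtain ⟨a, ha0, ha⟩ := exists_rep_mk_eq_smul (y σ) (hy0 σ)
    refine ⟨?_, ?_⟩
    · change (mk ℝ (y σ) (hy0 σ)).rep ∈ W
      rw [ha]
      exact W.smul_mem _ (W.add_mem (W.smul_mem _ hp) (W.smul_mem _ hq))
    · rintro (h | h)
      · change mk ℝ (y σ) (hy0 σ) = p at h
        rw [h] at ha
        have := (hli (a * (σ.1.1 * α) - 1) (a * (σ.1.2 * β)) (by
          rw [sub_smul, one_smul]; nth_rw 2 [ha]; simp only [y]; module)).2
        simp [ha0, h2.ne', hβ] at this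
      · change mk ℝ (y σ) (hy0 σ) = q at h
        rw [h] at ha
        have := (hli (a * (σ.1.1 * α)) (a * (σ.1.2 * β) - 1) (by
          rw [sub_smul, one_smul]; nth_rw 2 [ha]; simp only [y]; module)).1
        simp [ha0, h1.ne', hα] at this

lemma Adjacent.exists_pos {n : ℕ} {f : Fin n → RP2} (hf : SimpleCfg f) {i j : Fin n}
    (hij : i ≠ j) (h : Adjacent f i j) :
    ∃ c : ℝ, ∀ k l : Fin n, k ≠ i → k ≠ j → l ≠ i → l ≠ j → k ≠ l →
      ∀ φ : (Fin 3 → ℝ) →ₗ[ℝ] ℝ, φ ≠ 0 → φ (f k).rep = 0 → φ (f l).rep = 0 →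
        0 < c * (φ (f i).rep * φ (f j).rep) := by
  obtain ⟨_, ⟨W, hW, rfl⟩, hi, hj, x, ⟨hxW, hx⟩, hcomp⟩ := h
  have hne : f i ≠ f j := fun h => hij (hf.1 h)
  have hli := linearIndependent_rep_pair hne
  change (f i).rep ∈ W at hi
  change (f j).rep ∈ W at hj
  change x.rep ∈ W at hxW
  have hxW' := hxW
  rw [eq_span_pair_of_finrank_eq_two hW hi hj hli, Submodule.mem_span_pair] at hxW'
  obtain ⟨α, β, hαβ⟩ := hxW'
  have hα : α ≠ 0 := by
    rintro rfl
    exact hx (Or.inr (eq_of_rep_eq_smul (a := β) (by simp [← hαβ])))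
  have hβ : β ≠ 0 := by
    rintro rfl
    exact hx (Or.inl (eq_of_rep_eq_smul (a := α) (by simp [← hαβ])))
  refine ⟨α * β, fun k l hki hkj hli' hlj hkl φ hφ hk hl => ?_⟩
  have hφi := hf.dual_ne_zero hkl hki hli' hφ hk hl
  have hφj := hf.dual_ne_zero hkl hkj hlj hφ hk hl
  by_contra hcon
  have hne0 : α * β * (φ (f i).rep * φ (f j).rep) ≠ 0 := by positivity
  have hneg := lt_of_le_of_ne (not_lt.1 hcon) hne0
  have hs : 0 < (β * φ (f j).rep) ^ 2 := by positivity
  have ht : 0 < -(α * β * (φ (f i).rep * φ (f j).rep)) := by linarith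
  have hy : ((β * φ (f j).rep) ^ 2 * α) • (f i).rep
      + (-(α * β * (φ (f i).rep * φ (f j).rep)) * β) • (f j).rep ≠ 0 := by
    intro h0
    have := (LinearIndependent.pair_iff.1 hli _ _ h0).1
    simp [hβ, hφj, hα] at this
  have hmem := mk_mem_connectedComponentIn hi hj hne hα hβ hαβ.symm hs ht hy
  have hempty := hcomp k l hki hkj hli' hlj hkl _ (isProjLine_dual hφ) hk hl
  refine (Set.eq_empty_iff_forall_notMem.1 hempty) _ ⟨hmem, ?_⟩
  obtain ⟨a, -, ha⟩ := exists_rep_mk_eq_smul _ hy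
  change φ _ = 0
  rw [ha]
  simp only [map_smul, map_add, smul_eq_mul]
  ring

/-! ### Conics through the vertices of a projective frame -/

lemma SimpleCfg.exists_frame {n : ℕ} {f : Fin n → RP2} (hf : SimpleCfg f) {a b c d : Fin n}
    (hab : a ≠ b) (hac : a ≠ c) (had : a ≠ d) (hbc : b ≠ c) (hbd : b ≠ d) (hcd : c ≠ d) :
    ∃ (e : Module.Basis (Fin 3) ℝ (Fin 3 → ℝ)) (r s t : ℝ), r ≠ 0 ∧ s ≠ 0 ∧ t ≠ 0 ∧
      (f a).rep = r • e 0 ∧ (f b).rep = s • e 1 ∧ (f c).rep = t • e 2 ∧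
      (f d).rep = e 0 + e 1 + e 2 := by
  have hli := not_not.1 (hf.2 a b c hab hac hbc)
  let b₀ := basisOfLinearIndependentOfCardEqFinrank hli (by simp)
  have hb₀ : ⇑b₀ = ![(f a).rep, (f b).rep, (f c).rep] :=
    coe_basisOfLinearIndependentOfCardEqFinrank hli (by simp)
  have h0 : b₀ 0 = (f a).rep := by simp [hb₀]
  have h1 : b₀ 1 = (f b).rep := by simp [hb₀]
  have h2 : b₀ 2 = (f c).rep := by simp [hb₀]
  have hne : ∀ k, b₀.coord k ≠ 0 := by
    intro k hk
    simpa using congrArg (fun φ => φ (b₀ k)) hk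
  have hd0 : b₀.coord 0 (f d).rep ≠ 0 :=
    hf.dual_ne_zero hbc hbd hcd (hne 0) (by simp [← h1]) (by simp [← h2])
  have hd1 : b₀.coord 1 (f d).rep ≠ 0 :=
    hf.dual_ne_zero hac had hcd (hne 1) (by simp [← h0]) (by simp [← h2])
  have hd2 : b₀.coord 2 (f d).rep ≠ 0 :=
    hf.dual_ne_zero hab had hbd (hne 2) (by simp [← h0]) (by simp [← h1])
  have hd : ∀ k, b₀.coord k (f d).rep ≠ 0 := by
    intro k
    fin_cases k <;> assumption
  refine ⟨b₀.isUnitSMul fun k => (hd k).isUnit, _, _, _, inv_ne_zero hd0, inv_ne_zero hd1,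
    inv_ne_zero hd2, ?_, ?_, ?_, ?_⟩
  · rw [Module.Basis.isUnitSMul_apply, smul_smul, inv_mul_cancel₀ hd0, one_smul, h0]
  · rw [Module.Basis.isUnitSMul_apply, smul_smul, inv_mul_cancel₀ hd1, one_smul, h1]
  · rw [Module.Basis.isUnitSMul_apply, smul_smul, inv_mul_cancel₀ hd2, one_smul, h2]
  · simp only [Module.Basis.isUnitSMul_apply]
    exact (b₀.sum_repr (f d).rep).symm.trans (Fin.sum_univ_three _)

section

variable {e : Module.Basis (Fin 3) ℝ (Fin 3 → ℝ)}

lemma QuadraticForm.eq_of_basis_isotropic {Q : QuadraticForm ℝ (Fin 3 → ℝ)}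
    (h0 : Q (e 0) = 0) (h1 : Q (e 1) = 0) (h2 : Q (e 2) = 0) (v : Fin 3 → ℝ) :
    Q v = QuadraticMap.polar Q (e 1) (e 2) * (e.coord 1 v * e.coord 2 v)
      + QuadraticMap.polar Q (e 0) (e 2) * (e.coord 0 v * e.coord 2 v)
      + QuadraticMap.polar Q (e 0) (e 1) * (e.coord 0 v * e.coord 1 v) := by
  conv_lhs => rw [← e.sum_repr v]
  simp only [Fin.sum_univ_three, QuadraticMap.map_add Q, QuadraticMap.map_smul,
    QuadraticMap.polar_add_left, QuadraticMap.polar_smul_left, QuadraticMap.polar_smul_right,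
    h0, h1, h2, smul_eq_mul, Module.Basis.coord_apply]
  ring

section

variable {Q : QuadraticForm ℝ (Fin 3 → ℝ)} {A B C : ℝ} {p : RP2}

lemma insideConic_of_pos
    (hQ : ∀ v, Q v = A * (e.coord 1 v * e.coord 2 v) + B * (e.coord 0 v * e.coord 2 v)
      + C * (e.coord 0 v * e.coord 1 v))
    (hp : e.coord 2 p.rep ≠ 0) (h : 0 < A * B * C * Q p.rep) : InsideConic Q p := by
  refine insideConic_of_polar_sq_ge (by rintro h0; simp [h0] at h) fun v => ?_
  simp only [QuadraticMap.polar, hQ, map_add] at h ⊢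
  set x := e.coord 0 p.rep
  set y := e.coord 1 p.rep
  set z := e.coord 2 p.rep
  set x' := e.coord 0 v
  set y' := e.coord 1 v
  set z' := e.coord 2 v
  set q := A * (y * z) + B * (x * z) + C * (x * y) with hq
  have ha : B * z + C * y ≠ 0 := by
    intro h0
    have h1 : C * q = -(A * B * z ^ 2) := by
      rw [hq]
      linear_combination (A * z + C * x) * h0
    have h2 : 0 < -(A * B * z) ^ 2 := by
      calc 0 < A * B * C * q := h
        _ = _ := by linear_combination (A * B) * h1
    nlinarith [sq_nonneg (A * B * z)]
  have hpos : 0 < (B * z + C * y) ^ 2 * z ^ 2 := by positivity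
  refine nonneg_of_mul_nonneg_right ?_ hpos
  have h3 : 0 ≤ 4 * (A * B * C * q) * z ^ 2 * (z * y' - y * z') ^ 2 := by positivity
  have h4 := sq_nonneg ((B * z + C * y) ^ 2 * (z * x' - x * z')
    + ((B * z + C * y) * (A * z + C * x) - 2 * C * q) * (z * y' - y * z'))
  calc (0 : ℝ) ≤ _ := add_nonneg h4 h3
    _ = _ := by rw [hq]; ring

lemma outsideConic_of_neg
    (hQ : ∀ v, Q v = A * (e.coord 1 v * e.coord 2 v) + B * (e.coord 0 v * e.coord 2 v)
      + C * (e.coord 0 v * e.coord 1 v))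
    (hp : e.coord 2 p.rep ≠ 0) (h : A * B * C * Q p.rep < 0) : OutsideConic Q p := by
  suffices H : ∃ s t : ℝ, QuadraticMap.polar Q p.rep (s • e 0 + t • e 1) ^ 2
      - 4 * Q p.rep * Q (s • e 0 + t • e 1) < 0 by
    obtain ⟨s, t, H⟩ := H
    exact outsideConic_of_polar_sq_lt H
  have hC : C ≠ 0 := by rintro rfl; simp at h
  have hq0 : Q p.rep ≠ 0 := by intro h0; simp [h0] at h
  have hs : ∀ s t : ℝ, e.coord 0 (s • e 0 + t • e 1) = s ∧ e.coord 1 (s • e 0 + t • e 1) = t ∧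
      e.coord 2 (s • e 0 + t • e 1) = 0 := by
    intro s t
    refine ⟨?_, ?_, ?_⟩ <;> simp
  simp only [QuadraticMap.polar, hQ, map_add (e.coord _) p.rep, hs] at h hq0 ⊢
  set x := e.coord 0 p.rep
  set y := e.coord 1 p.rep
  set z := e.coord 2 p.rep
  set q := A * (y * z) + B * (x * z) + C * (x * y) with hq
  by_cases ha : B * z + C * y = 0
  · refine ⟨((A * z + C * x) ^ 2 + 1) / (4 * C * q), 1, ?_⟩
    have key : 4 * C * q * (((A * z + C * x) ^ 2 + 1) / (4 * C * q))
        = (A * z + C * x) ^ 2 + 1 := by field_simp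
    set s := ((A * z + C * x) ^ 2 + 1) / (4 * C * q)
    calc _ = (-1 : ℝ) := by
          linear_combination (-1 : ℝ) * key
            + (s ^ 2 * (B * z + C * y) + 2 * s * (A * z + C * x)) * ha
      _ < 0 := by norm_num
  · refine ⟨-((B * z + C * y) * (A * z + C * x) - 2 * C * q), (B * z + C * y) ^ 2, ?_⟩
    have hpos : 0 < 4 * (B * z + C * y) ^ 2 * z ^ 2 := by positivity
    calc _ = 4 * (B * z + C * y) ^ 2 * z ^ 2 * (A * B * C * q) := by
          rw [hq]
          ring
      _ < 0 := mul_neg_of_pos_of_neg hpos h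

end

/-- The conic through the frame points `e 0`, `e 1`, `e 2`, `e 0 + e 1 + e 2` and the point `v`. -/
def frameConic (e : Module.Basis (Fin 3) ℝ (Fin 3 → ℝ)) (v : Fin 3 → ℝ) :
    QuadraticForm ℝ (Fin 3 → ℝ) :=
  (e.coord 0 v * (e.coord 1 v - e.coord 2 v)) • QuadraticMap.linMulLin (e.coord 1) (e.coord 2)
    + (e.coord 1 v * (e.coord 2 v - e.coord 0 v)) •
      QuadraticMap.linMulLin (e.coord 0) (e.coord 2)
    + (e.coord 2 v * (e.coord 0 v - e.coord 1 v)) •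
      QuadraticMap.linMulLin (e.coord 0) (e.coord 1)

/-- The product of the linear forms cutting out the six lines through two points of the frame. -/
def frameLines (e : Module.Basis (Fin 3) ℝ (Fin 3 → ℝ)) (v : Fin 3 → ℝ) : ℝ :=
  e.coord 0 v * e.coord 1 v * e.coord 2 v * (e.coord 0 v - e.coord 1 v)
    * (e.coord 1 v - e.coord 2 v) * (e.coord 2 v - e.coord 0 v)

lemma frameConic_apply (v w : Fin 3 → ℝ) :
    frameConic e v w =
      (e.coord 0 v * (e.coord 1 v - e.coord 2 v)) * (e.coord 1 w * e.coord 2 w)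
        + (e.coord 1 v * (e.coord 2 v - e.coord 0 v)) * (e.coord 0 w * e.coord 2 w)
        + (e.coord 2 v * (e.coord 0 v - e.coord 1 v)) * (e.coord 0 w * e.coord 1 w) := rfl

lemma frameConic_swap (v w : Fin 3 → ℝ) : frameConic e w v = -frameConic e v w := by
  simp only [frameConic_apply]
  ring

lemma frameConic_vanishes (v : Fin 3 → ℝ) :
    frameConic e v (e 0) = 0 ∧ frameConic e v (e 1) = 0 ∧ frameConic e v (e 2) = 0 ∧
      frameConic e v (e 0 + e 1 + e 2) = 0 ∧ frameConic e v v = 0 := by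
  refine ⟨?_, ?_, ?_, ?_, ?_⟩
  · simp [frameConic_apply]
  · simp [frameConic_apply]
  · simp [frameConic_apply]
  · simp [frameConic_apply]
    ring
  · rw [frameConic_apply]
    ring

lemma frameConic_ne_zero {v : Fin 3 → ℝ} (hv : frameLines e v ≠ 0) : frameConic e v ≠ 0 := by
  intro h
  have h1 : frameConic e v (e 1 + e 2) = 0 := by simp [h]
  have h2 : e.coord 0 v * (e.coord 1 v - e.coord 2 v) = 0 := by
    simpa [frameConic_apply] using h1
  apply hv
  rw [frameLines]
  linear_combination (e.coord 1 v * e.coord 2 v * (e.coord 0 v - e.coord 1 v)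
    * (e.coord 2 v - e.coord 0 v)) * h2

lemma exists_eq_smul_frameConic {Q : QuadraticForm ℝ (Fin 3 → ℝ)} {v : Fin 3 → ℝ}
    (hv : frameLines e v ≠ 0) (h : Q (e 0) = 0 ∧ Q (e 1) = 0 ∧ Q (e 2) = 0 ∧
      Q (e 0 + e 1 + e 2) = 0 ∧ Q v = 0) : ∃ a : ℝ, Q = a • frameConic e v := by
  obtain ⟨h0, h1, h2, h3, h4⟩ := h
  have hQ := QuadraticForm.eq_of_basis_isotropic h0 h1 h2
  rw [hQ] at h3 h4
  set A := QuadraticMap.polar Q (e 1) (e 2)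
  set B := QuadraticMap.polar Q (e 0) (e 2)
  set C := QuadraticMap.polar Q (e 0) (e 1)
  have h5 : A + B + C = 0 := by simpa using h3
  have hne : e.coord 0 v * (e.coord 1 v - e.coord 2 v) ≠ 0 := by
    intro h
    apply hv
    rw [frameLines]
    linear_combination (e.coord 1 v * e.coord 2 v * (e.coord 0 v - e.coord 1 v)
      * (e.coord 2 v - e.coord 0 v)) * h
  refine ⟨A / (e.coord 0 v * (e.coord 1 v - e.coord 2 v)), QuadraticMap.ext fun w => ?_⟩
  rw [smul_apply, frameConic_apply, hQ, smul_eq_mul]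
  have hA : A = A / (e.coord 0 v * (e.coord 1 v - e.coord 2 v))
      * (e.coord 0 v * (e.coord 1 v - e.coord 2 v)) := (div_mul_cancel₀ A hne).symm
  set κ := A / (e.coord 0 v * (e.coord 1 v - e.coord 2 v))
  have hB : B = κ * (e.coord 1 v * (e.coord 2 v - e.coord 0 v)) := by
    apply mul_left_cancel₀ hne
    linear_combination (e.coord 0 v * e.coord 1 v) * h5 - h4
      + (e.coord 1 v * (e.coord 2 v - e.coord 0 v)) * hA
  have hC : C = κ * (e.coord 2 v * (e.coord 0 v - e.coord 1 v)) := by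
    linear_combination h5 - hA - hB
  rw [hB, hC]
  linear_combination (e.coord 1 w * e.coord 2 w) * hA

section

variable {n : ℕ} {f : Fin n → RP2} {i : Fin n} {v : Fin 3 → ℝ}

lemma subdominant_and_not_dominant_of_frame
    (hf : ∀ Q : QuadraticForm ℝ (Fin 3 → ℝ), (∀ k, k ≠ i → Q (f k).rep = 0) ↔
      (Q (e 0) = 0 ∧ Q (e 1) = 0 ∧ Q (e 2) = 0 ∧ Q (e 0 + e 1 + e 2) = 0 ∧ Q v = 0))
    (hi : e.coord 2 (f i).rep ≠ 0) (h : 0 < frameLines e v * frameConic e v (f i).rep) :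
    Subdominant f i ∧ ¬ Dominant f i := by
  have hv : frameLines e v ≠ 0 := by intro h0; simp [h0] at h
  have hsub : Subdominant f i := by
    intro Q hQ0 hQ
    obtain ⟨a, rfl⟩ := exists_eq_smul_frameConic hv ((hf Q).1 hQ)
    have ha : a ≠ 0 := by rintro rfl; simp at hQ0
    refine insideConic_of_pos (e := e)
      (A := a * (e.coord 0 v * (e.coord 1 v - e.coord 2 v)))
      (B := a * (e.coord 1 v * (e.coord 2 v - e.coord 0 v)))
      (C := a * (e.coord 2 v * (e.coord 0 v - e.coord 1 v))) (fun w => ?_) hi ?_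
    · rw [smul_apply, frameConic_apply, smul_eq_mul]
      ring
    · have : 0 < a ^ 4 * (frameLines e v * frameConic e v (f i).rep) := by positivity
      rw [smul_apply, smul_eq_mul]
      calc _ < _ := this
        _ = _ := by rw [frameLines]; ring
  refine ⟨hsub, fun hdom => ?_⟩
  have hvan := (hf _).2 (frameConic_vanishes (e := e) v)
  exact (hdom _ (frameConic_ne_zero hv) hvan).not_insideConic
    (hsub _ (frameConic_ne_zero hv) hvan)

lemma dominant_and_not_subdominant_of_frame
    (hf : ∀ Q : QuadraticForm ℝ (Fin 3 → ℝ), (∀ k, k ≠ i → Q (f k).rep = 0) ↔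
      (Q (e 0) = 0 ∧ Q (e 1) = 0 ∧ Q (e 2) = 0 ∧ Q (e 0 + e 1 + e 2) = 0 ∧ Q v = 0))
    (hi : e.coord 2 (f i).rep ≠ 0) (h : frameLines e v * frameConic e v (f i).rep < 0) :
    Dominant f i ∧ ¬ Subdominant f i := by
  have hv : frameLines e v ≠ 0 := by intro h0; simp [h0] at h
  have hdom : Dominant f i := by
    intro Q hQ0 hQ
    obtain ⟨a, rfl⟩ := exists_eq_smul_frameConic hv ((hf Q).1 hQ)
    have ha : a ≠ 0 := by rintro rfl; simp at hQ0
    refine outsideConic_of_neg (e := e)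
      (A := a * (e.coord 0 v * (e.coord 1 v - e.coord 2 v)))
      (B := a * (e.coord 1 v * (e.coord 2 v - e.coord 0 v)))
      (C := a * (e.coord 2 v * (e.coord 0 v - e.coord 1 v))) (fun w => ?_) hi ?_
    · rw [smul_apply, frameConic_apply, smul_eq_mul]
      ring
    · have : a ^ 4 * (frameLines e v * frameConic e v (f i).rep) < 0 :=
        mul_neg_of_pos_of_neg (by positivity) h
      rw [smul_apply, smul_eq_mul]
      calc _ = _ := by rw [frameLines]; ring
        _ < _ := this
  refine ⟨hdom, fun hsub => ?_⟩
  have hvan := (hf _).2 (frameConic_vanishes (e := e) v)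
  exact (hdom _ (frameConic_ne_zero hv) hvan).not_insideConic
    (hsub _ (frameConic_ne_zero hv) hvan)

end

end

lemma exists_perm_fin_six {i j : Fin 6} (hij : i ≠ j) :
    ∃ σ : Equiv.Perm (Fin 6), σ 0 = i ∧ σ 1 = j := by
  refine ⟨Equiv.swap (Equiv.swap 0 i 1) j * Equiv.swap 0 i, ?_, ?_⟩
  · rw [Equiv.Perm.mul_apply, Equiv.swap_apply_left]
    refine Equiv.swap_apply_of_ne_of_ne (fun h => ?_) hij
    have h1 : Equiv.swap 0 i 0 = Equiv.swap 0 i 1 := by rwa [Equiv.swap_apply_left]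
    exact zero_ne_one ((Equiv.swap 0 i).injective h1)
  · rw [Equiv.Perm.mul_apply, Equiv.swap_apply_left]

/-- In a typical 6-configuration, two adjacent points consist of exactly one dominant and
one subdominant point. -/
theorem adjacent_dominant_subdominant (f : Fin 6 → RP2) (hf : TypicalCfg f)
    (i j : Fin 6) (hij : i ≠ j) (hadj : Adjacent f i j) :
    (Dominant f i ∧ Subdominant f j ∧ ¬ Dominant f j ∧ ¬ Subdominant f i) ∨
    (Dominant f j ∧ Subdominant f i ∧ ¬ Dominant f i ∧ ¬ Subdominant f j) := by
  obtain ⟨σ, rfl, rfl⟩ := exists_perm_fin_six hij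
  have hσ : ∀ {k l : Fin 6}, k ≠ l → σ k ≠ σ l := fun h h' => h (σ.injective h')
  have hs := hf.1
  obtain ⟨e, r, s, t, hr, hs', ht, h2, h3, h4, h5⟩ := hs.exists_frame
    (hσ (show (2 : Fin 6) ≠ 3 by decide)) (hσ (show (2 : Fin 6) ≠ 4 by decide))
    (hσ (show (2 : Fin 6) ≠ 5 by decide)) (hσ (show (3 : Fin 6) ≠ 4 by decide))
    (hσ (show (3 : Fin 6) ≠ 5 by decide)) (hσ (show (4 : Fin 6) ≠ 5 by decide))
  have hQ2 (Q : QuadraticForm ℝ (Fin 3 → ℝ)) : Q (f (σ 2)).rep = 0 ↔ Q (e 0) = 0 := by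
    rw [h2, QuadraticMap.map_smul]; simp [hr]
  have hQ3 (Q : QuadraticForm ℝ (Fin 3 → ℝ)) : Q (f (σ 3)).rep = 0 ↔ Q (e 1) = 0 := by
    rw [h3, QuadraticMap.map_smul]; simp [hs']
  have hQ4 (Q : QuadraticForm ℝ (Fin 3 → ℝ)) : Q (f (σ 4)).rep = 0 ↔ Q (e 2) = 0 := by
    rw [h4, QuadraticMap.map_smul]; simp [ht]
  have hall {P : Fin 6 → Prop} : (∀ k, P k) ↔
      P (σ 0) ∧ P (σ 1) ∧ P (σ 2) ∧ P (σ 3) ∧ P (σ 4) ∧ P (σ 5) := by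
    rw [← σ.forall_congr_right (q := P)]
    simp [Fin.forall_fin_succ]
  have hcov0 (Q : QuadraticForm ℝ (Fin 3 → ℝ)) : (∀ k, k ≠ σ 0 → Q (f k).rep = 0) ↔
      (Q (e 0) = 0 ∧ Q (e 1) = 0 ∧ Q (e 2) = 0 ∧ Q (e 0 + e 1 + e 2) = 0 ∧
        Q (f (σ 1)).rep = 0) := by
    rw [hall, hQ2, hQ3, hQ4, h5]
    simp only [ne_eq, σ.injective.eq_iff]
    simp
    tauto
  have hcov1 (Q : QuadraticForm ℝ (Fin 3 → ℝ)) : (∀ k, k ≠ σ 1 → Q (f k).rep = 0) ↔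
      (Q (e 0) = 0 ∧ Q (e 1) = 0 ∧ Q (e 2) = 0 ∧ Q (e 0 + e 1 + e 2) = 0 ∧
        Q (f (σ 0)).rep = 0) := by
    rw [hall, hQ2, hQ3, hQ4, h5]
    simp only [ne_eq, σ.injective.eq_iff]
    simp
    tauto
  obtain ⟨c, hc⟩ := hadj.exists_pos hs hij
  have hline (k l : Fin 6) (hk0 : k ≠ 0) (hk1 : k ≠ 1) (hl0 : l ≠ 0) (hl1 : l ≠ 1) (hkl : k ≠ l)
      (φ : (Fin 3 → ℝ) →ₗ[ℝ] ℝ) (w : Fin 3 → ℝ) (hφ : φ w ≠ 0)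
      (hk : φ (f (σ k)).rep = 0) (hl : φ (f (σ l)).rep = 0) :
      0 < c * (φ (f (σ 0)).rep * φ (f (σ 1)).rep) :=
    hc _ _ (hσ hk0) (hσ hk1) (hσ hl0) (hσ hl1) (hσ hkl) φ (by rintro rfl; simp at hφ) hk hl
  have l0 := hline 3 4 (by decide) (by decide) (by decide) (by decide) (by decide)
    (e.coord 0) (e 0) (by simp) (by simp [h3]) (by simp [h4])
  have l1 := hline 2 4 (by decide) (by decide) (by decide) (by decide) (by decide)
    (e.coord 1) (e 1) (by simp) (by simp [h2]) (by simp [h4])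
  have l2 := hline 2 3 (by decide) (by decide) (by decide) (by decide) (by decide)
    (e.coord 2) (e 2) (by simp) (by simp [h2]) (by simp [h3])
  have l01 := hline 4 5 (by decide) (by decide) (by decide) (by decide) (by decide)
    (e.coord 0 - e.coord 1) (e 0) (by simp) (by simp [h4]) (by simp [h5])
  have l12 := hline 2 5 (by decide) (by decide) (by decide) (by decide) (by decide)
    (e.coord 1 - e.coord 2) (e 1) (by simp) (by simp [h2]) (by simp [h5])
  have l20 := hline 3 5 (by decide) (by decide) (by decide) (by decide) (by decide)
    (e.coord 2 - e.coord 0) (e 2) (by simp) (by simp [h3]) (by simp [h5])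
  have hi : e.coord 2 (f (σ 0)).rep ≠ 0 := by intro h; simp [h] at l2
  have hj : e.coord 2 (f (σ 1)).rep ≠ 0 := by intro h; simp [h] at l2
  have hF : 0 < frameLines e (f (σ 0)).rep * frameLines e (f (σ 1)).rep := by
    have h6 := mul_pos (mul_pos (mul_pos l0 l1) (mul_pos l2 l01)) (mul_pos l12 l20)
    simp only [LinearMap.sub_apply] at h6
    refine pos_of_mul_pos_right (a := c ^ 6) ?_ (Even.pow_nonneg (by decide) c)
    calc _ < _ := h6
      _ = _ := by simp only [frameLines]; ring
  have hj0 : frameLines e (f (σ 1)).rep ≠ 0 := by intro h; simp [h] at hF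
  have hG : frameConic e (f (σ 1)).rep (f (σ 0)).rep ≠ 0 := by
    intro h0
    refine hf.2 σ σ.injective ⟨_, frameConic_ne_zero hj0, ?_⟩
    rintro _ ⟨k, rfl⟩
    by_cases hk : k = 0
    · rw [hk]; exact h0
    · exact (hcov0 _).2 (frameConic_vanishes _) _ (hσ hk)
  have hprod : frameLines e (f (σ 1)).rep * frameConic e (f (σ 1)).rep (f (σ 0)).rep *
      (frameLines e (f (σ 0)).rep * frameConic e (f (σ 0)).rep (f (σ 1)).rep) < 0 := by
    have := mul_pos hF (sq_pos_of_ne_zero hG)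
    rw [frameConic_swap (f (σ 1)).rep (f (σ 0)).rep]
    nlinarith
  rcases mul_neg_iff.1 hprod with ⟨ha, hb⟩ | ⟨ha, hb⟩
  · obtain ⟨a1, a2⟩ := subdominant_and_not_dominant_of_frame hcov0 hi ha
    obtain ⟨b1, b2⟩ := dominant_and_not_subdominant_of_frame hcov1 hj hb
    exact Or.inr ⟨b1, a1, a2, b2⟩
  · obtain ⟨a1, a2⟩ := dominant_and_not_subdominant_of_frame hcov0 hi ha
    obtain ⟨b1, b2⟩ := subdominant_and_not_dominant_of_frame hcov1 hj hb
    exact Or.inl ⟨a1, b1, b2, a2⟩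

end
end

section
/- Let P be a hexagonal typical 6-configuration with consecutive cyclic labeling p₁,…,p₆ coming from its convex position (indices modulo 6). Then dominant and subdominant points alternate along the cyclic order: p_i is dominant if and only if p_{i+1} is subdominant. In particular P has exactly three dominant and exactly three subdominant points. -/
open scoped LinearAlgebra.Projectivization
open Projectivization

noncomputable section

/-- The determinant of three vectors of `ℝ³`. -/
def bracket (a b c : Fin 3 → ℝ) : ℝ := (Matrix.of ![a, b, c]).det

lemma bracket_eq (a b c : Fin 3 → ℝ) : bracket a b c =
    a 0 * b 1 * c 2 - a 0 * b 2 * c 1 - a 1 * b 0 * c 2 + a 1 * b 2 * c 0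
      + a 2 * b 0 * c 1 - a 2 * b 1 * c 0 := by
  simp [bracket, Matrix.det_fin_three]

lemma bracket_rotate (a b c : Fin 3 → ℝ) : bracket b c a = bracket a b c := by
  simp only [bracket_eq]; ring

lemma bracket_swap (a b c : Fin 3 → ℝ) : bracket a c b = -bracket a b c := by
  simp only [bracket_eq]; ring

lemma bracket_self_left (a b : Fin 3 → ℝ) : bracket a a b = 0 := by
  simp only [bracket_eq]; ring

lemma bracket_self_right (a b : Fin 3 → ℝ) : bracket a b b = 0 := by
  simp only [bracket_eq]; ring

lemma bracket_self_outer (a b : Fin 3 → ℝ) : bracket a b a = 0 := by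
  simp only [bracket_eq]; ring

lemma bracket_smul (r s t : ℝ) (a b c : Fin 3 → ℝ) :
    bracket (r • a) (s • b) (t • c) = r * s * t * bracket a b c := by
  simp only [bracket_eq, Pi.smul_apply, smul_eq_mul]; ring

lemma bracket_ne_zero {a b c : Fin 3 → ℝ} (h : LinearIndependent ℝ ![a, b, c]) :
    bracket a b c ≠ 0 := by
  have := (Matrix.linearIndependent_rows_iff_isUnit (A := Matrix.of ![a, b, c])).1 h
  exact ((Matrix.isUnit_iff_isUnit_det _).1 this).ne_zero

/-- The linear functional `x ↦ [x, b, c]`. -/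
def bracketDual (b c : Fin 3 → ℝ) : (Fin 3 → ℝ) →ₗ[ℝ] ℝ where
  toFun x := bracket x b c
  map_add' x y := by simp only [bracket_eq, Pi.add_apply]; ring
  map_smul' r x := by simp only [bracket_eq, Pi.smul_apply, smul_eq_mul, RingHom.id_apply]; ring

@[simp] lemma bracketDual_apply (b c x : Fin 3 → ℝ) : bracketDual b c x = bracket x b c := rfl

/-- Cramer's rule. -/
lemma bracket_smul_eq (a b c x : Fin 3 → ℝ) :
    bracket a b c • x = bracket x b c • a + bracket x c a • b + bracket x a b • c := by
  ext i
  fin_cases i <;>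
    simp only [bracket_eq, Pi.smul_apply, smul_eq_mul, Pi.add_apply, Fin.zero_eta, Fin.mk_one,
      Fin.reduceFinMk] <;> ring

/-- The three-term Grassmann–Plücker relation. -/
lemma bracket_plucker (a b c d e : Fin 3 → ℝ) :
    bracket a b d * bracket a c e = bracket a b c * bracket a d e + bracket a b e * bracket a c d := by
  simp only [bracket_eq]; ring

/-- A functional vanishing at `a` and `b` is proportional to `[a, b, ·]`. -/
lemma bracket_mul_apply (g : (Fin 3 → ℝ) →ₗ[ℝ] ℝ) {a b : Fin 3 → ℝ} (ha : g a = 0) (hb : g b = 0)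
    (c d : Fin 3 → ℝ) : bracket a b c * g d = bracket a b d * g c := by
  have h := congrArg g (bracket_smul_eq a b c d)
  simp only [map_add, map_smul, ha, hb, smul_eq_mul, mul_zero, zero_add] at h
  rw [h, bracket_rotate d a b]

/-- In the coordinates `[x, b, c]`, `[x, c, a]`, `[x, a, b]`, the quadratic form of the conic
through `a, b, c, d, e`. -/
def conicForm (a b c d e : Fin 3 → ℝ) : QuadraticForm ℝ (Fin 3 → ℝ) :=
  (bracket d b c * bracket e b c * bracket a d e) •
      QuadraticMap.linMulLin (bracketDual c a) (bracketDual a b) +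
    (bracket d c a * bracket e c a * bracket b d e) •
      QuadraticMap.linMulLin (bracketDual a b) (bracketDual b c) +
    (bracket d a b * bracket e a b * bracket c d e) •
      QuadraticMap.linMulLin (bracketDual b c) (bracketDual c a)

lemma conicForm_apply (a b c d e x : Fin 3 → ℝ) : conicForm a b c d e x =
    bracket d b c * bracket e b c * bracket a d e * (bracket x c a * bracket x a b) +
    bracket d c a * bracket e c a * bracket b d e * (bracket x a b * bracket x b c) +
    bracket d a b * bracket e a b * bracket c d e * (bracket x b c * bracket x c a) := by
  simp [conicForm]

lemma bracket_mul_left (a b c d e : Fin 3 → ℝ) : bracket a b c * bracket a d e =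
    bracket d c a * bracket e a b - bracket d a b * bracket e c a := by
  simp only [bracket_eq]; ring

lemma bracket_mul_middle (a b c d e : Fin 3 → ℝ) : bracket a b c * bracket b d e =
    bracket d a b * bracket e b c - bracket d b c * bracket e a b := by
  simp only [bracket_eq]; ring

lemma bracket_mul_right (a b c d e : Fin 3 → ℝ) : bracket a b c * bracket c d e =
    bracket d b c * bracket e c a - bracket d c a * bracket e b c := by
  simp only [bracket_eq]; ring

lemma bracket_mul_conicForm (a b c d e x : Fin 3 → ℝ) : bracket a b c * conicForm a b c d e x =
    bracket d b c * bracket e b c *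
        (bracket d c a * bracket e a b - bracket d a b * bracket e c a) *
        (bracket x c a * bracket x a b) +
    bracket d c a * bracket e c a *
        (bracket d a b * bracket e b c - bracket d b c * bracket e a b) *
        (bracket x a b * bracket x b c) +
    bracket d a b * bracket e a b *
        (bracket d b c * bracket e c a - bracket d c a * bracket e b c) *
        (bracket x b c * bracket x c a) := by
  rw [conicForm_apply, ← bracket_mul_left, ← bracket_mul_middle, ← bracket_mul_right]; ring

/-- Ten brackets of five vectors are positive: the five points are the consecutive vertices of a
positively oriented convex pentagon, up to a projective transformation. -/
structure ConvexPentagon (a b c d e : Fin 3 → ℝ) : Prop where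
  abc : 0 < bracket a b c
  abd : 0 < bracket a b d
  abe : 0 < bracket a b e
  acd : 0 < bracket a c d
  ace : 0 < bracket a c e
  ade : 0 < bracket a d e
  bcd : 0 < bracket b c d
  bce : 0 < bracket b c e
  bde : 0 < bracket b d e
  cde : 0 < bracket c d e

lemma conicForm_swap {a b c : Fin 3 → ℝ} (h : bracket a b c ≠ 0) (d e x : Fin 3 → ℝ) :
    conicForm a b c d x e = -conicForm a b c d e x := by
  apply mul_left_cancel₀ h
  rw [mul_neg, bracket_mul_conicForm, bracket_mul_conicForm]; ring

namespace ConvexPentagon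

variable {a b c d e : Fin 3 → ℝ}

lemma weight_left_pos (h : ConvexPentagon a b c d e) :
    0 < bracket d b c * bracket e b c * bracket a d e := by
  rw [← bracket_rotate d b c, ← bracket_rotate e b c]
  exact mul_pos (mul_pos h.bcd h.bce) h.ade

lemma weight_middle_pos (h : ConvexPentagon a b c d e) :
    0 < bracket d c a * bracket e c a * bracket b d e := by
  rw [bracket_swap d a c, bracket_swap e a c, ← bracket_rotate d a c, ← bracket_rotate e a c,
    neg_mul_neg]
  exact mul_pos (mul_pos h.acd h.ace) h.bde

lemma weight_right_pos (h : ConvexPentagon a b c d e) :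
    0 < bracket d a b * bracket e a b * bracket c d e := by
  rw [← bracket_rotate d a b, ← bracket_rotate e a b]
  exact mul_pos (mul_pos h.abd h.abe) h.cde

lemma conicForm_vanish (h : ConvexPentagon a b c d e) :
    conicForm a b c d e a = 0 ∧ conicForm a b c d e b = 0 ∧ conicForm a b c d e c = 0 ∧
      conicForm a b c d e d = 0 ∧ conicForm a b c d e e = 0 := by
  refine ⟨?_, ?_, ?_, ?_, ?_⟩
  · simp [conicForm_apply, bracket_self_left, bracket_self_outer]
  · simp [conicForm_apply, bracket_self_left, bracket_self_outer]
  · simp [conicForm_apply, bracket_self_left, bracket_self_outer]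
  all_goals
    apply mul_left_cancel₀ h.abc.ne'
    rw [bracket_mul_conicForm]; ring

/-- The conic through the vertices of a convex pentagon is unique. -/
lemma exists_eq_smul (h : ConvexPentagon a b c d e) {q : QuadraticForm ℝ (Fin 3 → ℝ)} (hq : q ≠ 0)
    (ha : q a = 0) (hb : q b = 0) (hc : q c = 0) (hd : q d = 0) (he : q e = 0) :
    ∃ k : ℝ, k ≠ 0 ∧ ∀ x, q x = k * conicForm a b c d e x := by
  set A := QuadraticMap.polar q b c with hA
  set B := QuadraticMap.polar q c a with hB
  set C := QuadraticMap.polar q a b with hC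
  have key (x : Fin 3 → ℝ) : bracket a b c ^ 2 * q x = A * (bracket x c a * bracket x a b) +
      B * (bracket x a b * bracket x b c) + C * (bracket x b c * bracket x c a) := by
    have h1 := congrArg q (bracket_smul_eq a b c x)
    rw [QuadraticMap.map_smul, QuadraticMap.map_add q (_ + _), QuadraticMap.map_add q,
      QuadraticMap.map_smul, QuadraticMap.map_smul, QuadraticMap.map_smul, ha, hb, hc,
      QuadraticMap.polar_add_left] at h1
    simp only [QuadraticMap.polar_smul_left, QuadraticMap.polar_smul_right, smul_eq_mul] at h1
    rw [QuadraticMap.polar_comm q a c, ← hA, ← hB, ← hC] at h1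
    linear_combination h1
  have kd := key d
  have ke := key e
  rw [hd, mul_zero] at kd
  rw [he, mul_zero] at ke
  have hα := h.weight_left_pos
  set α := bracket d b c * bracket e b c * bracket a d e with hα'
  set β := bracket d c a * bracket e c a * bracket b d e with hβ'
  set γ := bracket d a b * bracket e a b * bracket c d e with hγ'
  have hAB : A * β = B * α := by
    apply mul_left_cancel₀ h.abc.ne'
    have e1 := bracket_mul_left a b c d e
    have e2 := bracket_mul_middle a b c d e
    rw [hα', hβ']
    linear_combination (A * bracket d c a * bracket e c a) * e2
      - (B * bracket d b c * bracket e b c) * e1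
      - (bracket e b c * bracket e c a) * kd + (bracket d b c * bracket d c a) * ke
  have hAC : A * γ = C * α := by
    apply mul_left_cancel₀ h.abc.ne'
    have e1 := bracket_mul_left a b c d e
    have e2 := bracket_mul_right a b c d e
    rw [hα', hγ']
    linear_combination (A * bracket d a b * bracket e a b) * e2
      - (C * bracket d b c * bracket e b c) * e1
      + (bracket e b c * bracket e a b) * kd - (bracket d b c * bracket d a b) * ke
  have hm := h.abc.ne'
  have hform (x : Fin 3 → ℝ) :
      q x = A / (α * bracket a b c ^ 2) * conicForm a b c d e x := by
    have h1 := key x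
    rw [conicForm_apply, ← hα', ← hβ', ← hγ']
    have : α ≠ 0 := hα.ne'
    field_simp
    linear_combination α * h1 - (bracket x a b * bracket x b c) * hAB
      - (bracket x b c * bracket x c a) * hAC
  refine ⟨_, fun h0 => hq ?_, hform⟩
  ext x
  rw [hform, h0]; simp

/-- The form of the conic through a convex pentagon has signature `(1, 2)`. -/
lemma exists_diagonal (h : ConvexPentagon a b c d e) :
    ∃ (k : ℝ) (l₀ l₁ l₂ : (Fin 3 → ℝ) →ₗ[ℝ] ℝ), 0 < k ∧
      (∀ x, k * conicForm a b c d e x = l₀ x ^ 2 - l₁ x ^ 2 - l₂ x ^ 2) ∧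
      ∀ x, l₀ x = 0 → l₁ x = 0 → l₂ x = 0 → x = 0 := by
  have hα := h.weight_left_pos
  have hβ := h.weight_middle_pos
  have hγ := h.weight_right_pos
  simp only [conicForm_apply]
  set α := bracket d b c * bracket e b c * bracket a d e
  set β := bracket d c a * bracket e c a * bracket b d e
  set γ := bracket d a b * bracket e a b * bracket c d e
  refine ⟨4 * (α * β * γ), (β * γ) • bracketDual b c + (α * γ) • bracketDual c a
      + (2 * α * β) • bracketDual a b, (β * γ) • bracketDual b c - (α * γ) • bracketDual c a,
      (2 * α * β) • bracketDual a b, by positivity, fun x => ?_, fun x h0 h1 h2 => ?_⟩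
  · simp only [LinearMap.add_apply, LinearMap.sub_apply, LinearMap.smul_apply, bracketDual_apply,
      smul_eq_mul]
    ring
  · simp only [LinearMap.add_apply, LinearMap.sub_apply, LinearMap.smul_apply, bracketDual_apply,
      smul_eq_mul] at h0 h1 h2
    have z : bracket x a b = 0 := (mul_eq_zero.1 h2).resolve_left (by positivity)
    have x' : bracket x b c = 0 :=
      (mul_eq_zero.1 (show β * γ * bracket x b c = 0 by linarith)).resolve_left (by positivity)
    have y : bracket x c a = 0 :=
      (mul_eq_zero.1 (show α * γ * bracket x c a = 0 by linarith)).resolve_left (by positivity)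
    have hx := bracket_smul_eq a b c x
    rw [x', y, z] at hx
    simpa [h.abc.ne'] using hx

end ConvexPentagon

section Signature

variable {q : QuadraticForm ℝ (Fin 3 → ℝ)} {k : ℝ} {l₀ l₁ l₂ : (Fin 3 → ℝ) →ₗ[ℝ] ℝ}

lemma outsideConic_of_neg_s3 (hdiag : ∀ x, k * q x = l₀ x ^ 2 - l₁ x ^ 2 - l₂ x ^ 2)
    (hinj : ∀ x, l₀ x = 0 → l₁ x = 0 → l₂ x = 0 → x = 0) {p : RP2} (hp : k * q p.rep < 0) :
    OutsideConic q p := by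
  rw [hdiag] at hp
  set v := p.rep
  set N := l₁ v ^ 2 + l₂ v ^ 2 with hN
  have hNpos : 0 < N := by nlinarith [sq_nonneg (l₀ v)]
  set g : (Fin 3 → ℝ) →ₗ[ℝ] ℝ := N • l₀ - l₀ v • (l₁ v • l₁ + l₂ v • l₂) with hg
  have hgx (x : Fin 3 → ℝ) : g x = N * l₀ x - l₀ v * (l₁ v * l₁ x + l₂ v * l₂ x) := by
    simp [hg, mul_add]
  have hsurj : Function.Surjective (LinearMap.pi ![l₀, l₁, l₂]) := by
    rw [← LinearMap.injective_iff_surjective, ← LinearMap.ker_eq_bot, LinearMap.ker_eq_bot']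
    intro x hx
    exact hinj x (by simpa using congrFun hx 0) (by simpa using congrFun hx 1)
      (by simpa using congrFun hx 2)
  have hg0 : g ≠ 0 := by
    obtain ⟨x, hx⟩ := hsurj ![1, 0, 0]
    intro h0
    have h1 := hgx x
    have x0 : l₀ x = 1 := by simpa using congrFun hx 0
    have x1 : l₁ x = 0 := by simpa using congrFun hx 1
    have x2 : l₂ x = 0 := by simpa using congrFun hx 2
    rw [h0, x0, x1, x2] at h1
    simp at h1
    exact hNpos.ne h1
  refine ⟨_, ⟨LinearMap.ker g, ?_, rfl⟩, ?_, ?_⟩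
  · have := Module.Dual.finrank_ker_add_one_of_ne_zero (f := g) hg0
    simp at this
    omega
  · change g v = 0
    rw [hgx, hN]; ring
  · rw [Set.eq_empty_iff_forall_notMem]
    rintro z ⟨hz : g z.rep = 0, hz' : q z.rep = 0⟩
    have h1 := hdiag z.rep
    have hzr := z.rep_nonzero
    rw [hz', mul_zero] at h1
    rw [hgx] at hz
    generalize z.rep = x at *
    set T := l₁ x ^ 2 + l₂ x ^ 2 with hT
    have hT0 : 0 ≤ T := by positivity
    have cs : (l₁ v * l₁ x + l₂ v * l₂ x) ^ 2 ≤ N * T := by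
      rw [hN, hT]; nlinarith [sq_nonneg (l₁ v * l₂ x - l₂ v * l₁ x)]
    have h2 : N ^ 2 * T = l₀ v ^ 2 * (l₁ v * l₁ x + l₂ v * l₂ x) ^ 2 := by
      have : l₀ x ^ 2 = T := by rw [hT]; linarith
      rw [← this, ← mul_pow, ← mul_pow]
      congr 1
      linarith
    have h3 : N ^ 2 * T ≤ l₀ v ^ 2 * (N * T) := by
      rw [h2]; exact mul_le_mul_of_nonneg_left cs (sq_nonneg _)
    have h4 : T = 0 := by
      by_contra hne
      have hTpos : 0 < T := lt_of_le_of_ne hT0 (Ne.symm hne)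
      have : 0 < N * T := mul_pos hNpos hTpos
      nlinarith
    have x1 : l₁ x = 0 := by nlinarith [sq_nonneg (l₁ x), sq_nonneg (l₂ x)]
    have x2 : l₂ x = 0 := by nlinarith [sq_nonneg (l₁ x), sq_nonneg (l₂ x)]
    have x0 : l₀ x = 0 := by
      rw [x1, x2] at h1
      nlinarith
    exact hzr (hinj x x0 x1 x2)

lemma insideConic_of_pos_s3 (hdiag : ∀ x, k * q x = l₀ x ^ 2 - l₁ x ^ 2 - l₂ x ^ 2)
    (hinj : ∀ x, l₀ x = 0 → l₁ x = 0 → l₂ x = 0 → x = 0) {p : RP2} (hp : 0 < k * q p.rep) :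
    InsideConic q p := by
  rintro _ ⟨W, hW, rfl⟩ (hpW : p.rep ∈ W)
  have hk : k ≠ 0 := by rintro rfl; simp at hp
  rw [hdiag] at hp
  obtain ⟨w, hwker, hw0⟩ := (Submodule.ne_bot_iff _).1
    (LinearMap.ker_ne_bot_of_finrank_lt (f := l₀.domRestrict W) (by rw [hW]; simp))
  have hw : l₀ w = 0 := hwker
  have hwne : (w : Fin 3 → ℝ) ≠ 0 := by simpa using hw0
  have hneg : 0 < l₁ w ^ 2 + l₂ w ^ 2 := by
    by_contra hle
    exact hwne (hinj _ hw (by nlinarith [sq_nonneg (l₁ w), sq_nonneg (l₂ w)])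
      (by nlinarith [sq_nonneg (l₁ w), sq_nonneg (l₂ w)]))
  set v := p.rep
  obtain ⟨t, ht⟩ := exists_quadratic_eq_zero (a := -(l₁ w ^ 2 + l₂ w ^ 2))
    (b := -2 * (l₁ v * l₁ w + l₂ v * l₂ w)) (c := l₀ v ^ 2 - l₁ v ^ 2 - l₂ v ^ 2)
    (by linarith) ⟨_, (Real.mul_self_sqrt (by
      rw [discrim]
      nlinarith [sq_nonneg (-2 * (l₁ v * l₁ w + l₂ v * l₂ w)), mul_pos hneg hp])).symm⟩
  have hroot : q (v + t • (w : Fin 3 → ℝ)) = 0 := by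
    have h1 := hdiag (v + t • (w : Fin 3 → ℝ))
    simp only [map_add, map_smul, smul_eq_mul, hw] at h1
    apply mul_left_cancel₀ hk
    rw [h1, mul_zero]
    linear_combination ht
  have hne : v + t • (w : Fin 3 → ℝ) ≠ 0 := by
    intro h0
    have hv : l₀ v = 0 := by
      have := congrArg l₀ h0
      simpa [hw] using this
    rw [hv] at hp
    nlinarith [sq_nonneg (l₁ v), sq_nonneg (l₂ v)]
  obtain ⟨r, hr⟩ := exists_smul_eq_mk_rep ℝ _ hne
  refine ⟨mk ℝ _ hne, ?_, ?_⟩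
  · change (mk ℝ _ hne).rep ∈ W
    rw [← hr]
    exact W.smul_mem (r : ℝ) (W.add_mem hpW (W.smul_mem t w.2))
  · change q (mk ℝ _ hne).rep = 0
    rw [← hr, Units.smul_def, QuadraticMap.map_smul, hroot, smul_zero]

end Signature

lemma InsideConic.not_outsideConic {q : QuadraticForm ℝ (Fin 3 → ℝ)} {p : RP2}
    (h : InsideConic q p) : ¬ OutsideConic q p := by
  rintro ⟨L, hL, hp, he⟩
  exact (h L hL hp).ne_empty he

section Configuration

variable {n : ℕ} {f : Fin n → RP2} {v : Fin n → Fin 3 → ℝ} {r : Fin n → ℝ} {i a b c d e : Fin n}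

lemma map_eq_zero_iff_rep (hr : ∀ j, r j ≠ 0) (hv : ∀ j, v j = r j • (f j).rep)
    (q : QuadraticForm ℝ (Fin 3 → ℝ)) (j : Fin n) : q (v j) = 0 ↔ q (f j).rep = 0 := by
  simp [hv, QuadraticMap.map_smul, hr j]

/-- Dominance is decided by the sign of the conic form through the five other points. -/
lemma dominance_iff_conicForm (hr : ∀ j, r j ≠ 0) (hv : ∀ j, v j = r j • (f j).rep)
    (hi : ∀ j, j ≠ i ↔ j = a ∨ j = b ∨ j = c ∨ j = d ∨ j = e)
    (h : ConvexPentagon (v a) (v b) (v c) (v d) (v e))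
    (hcc : ¬ Coconic (Set.range f)) :
    conicForm (v a) (v b) (v c) (v d) (v e) (v i) ≠ 0 ∧
    (Dominant f i ↔ conicForm (v a) (v b) (v c) (v d) (v e) (v i) < 0) ∧
    (Subdominant f i ↔ 0 < conicForm (v a) (v b) (v c) (v d) (v e) (v i)) := by
  obtain ⟨k, l₀, l₁, l₂, hk, hdiag, hinj⟩ := h.exists_diagonal
  have hvan := h.conicForm_vanish
  have huniq (q : QuadraticForm ℝ (Fin 3 → ℝ)) (hq : q ≠ 0) (hz : ∀ j, j ≠ i → q (f j).rep = 0) :=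
    have hz' (j : Fin n) (hj : j = a ∨ j = b ∨ j = c ∨ j = d ∨ j = e) : q (v j) = 0 :=
      (map_eq_zero_iff_rep hr hv q j).2 (hz j ((hi j).2 hj))
    h.exists_eq_smul hq (hz' a (by simp)) (hz' b (by simp)) (hz' c (by simp)) (hz' d (by simp))
      (hz' e (by simp))
  set Q := conicForm (v a) (v b) (v c) (v d) (v e)
  have hQz (j : Fin n) (hj : j ≠ i) : Q (f j).rep = 0 := by
    rw [← map_eq_zero_iff_rep hr hv]
    rcases (hi j).1 hj with rfl | rfl | rfl | rfl | rfl
    exacts [hvan.1, hvan.2.1, hvan.2.2.1, hvan.2.2.2.1, hvan.2.2.2.2]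
  have hsq : 0 < r i * r i := mul_self_pos.2 (hr i)
  have hQi : Q (v i) = r i * r i * Q (f i).rep := by
    rw [hv, QuadraticMap.map_smul, smul_eq_mul]
  have hQ0 : Q ≠ 0 := by
    intro h0
    have hx (x : Fin 3 → ℝ) : l₀ x ^ 2 = l₁ x ^ 2 + l₂ x ^ 2 := by
      have := hdiag x
      rw [h0] at this
      simp at this
      linarith
    obtain ⟨w, hwker, hw0⟩ := (Submodule.ne_bot_iff _).1
      (LinearMap.ker_ne_bot_of_finrank_lt (f := l₀) (by simp))
    have hw : l₀ w = 0 := hwker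
    have := hx w
    rw [hw] at this
    exact hw0 (hinj w hw (by nlinarith [sq_nonneg (l₁ w), sq_nonneg (l₂ w)])
      (by nlinarith [sq_nonneg (l₁ w), sq_nonneg (l₂ w)]))
  have hne : Q (v i) ≠ 0 := by
    intro h0
    refine hcc ⟨Q, hQ0, ?_⟩
    rintro _ ⟨j, rfl⟩
    by_cases hj : j = i
    · rw [hj]; exact (map_eq_zero_iff_rep hr hv Q i).1 h0
    · exact hQz j hj
  have hdiag' {q : QuadraticForm ℝ (Fin 3 → ℝ)} {t : ℝ} (ht : t ≠ 0) (hq : ∀ x, q x = t * Q x)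
      (x : Fin 3 → ℝ) : k / t * q x = l₀ x ^ 2 - l₁ x ^ 2 - l₂ x ^ 2 := by
    rw [← hdiag, hq]; field_simp
  have hdom (hs : Q (v i) < 0) : Dominant f i := by
    intro q hq hz
    obtain ⟨t, ht, hqt⟩ := huniq q hq hz
    refine outsideConic_of_neg_s3 (hdiag' ht hqt) hinj ?_
    rw [hdiag' ht hqt, ← hdiag]
    exact mul_neg_of_pos_of_neg hk (neg_of_mul_neg_right (hQi ▸ hs) hsq.le)
  have hsub (hs : 0 < Q (v i)) : Subdominant f i := by
    intro q hq hz
    obtain ⟨t, ht, hqt⟩ := huniq q hq hz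
    refine insideConic_of_pos_s3 (hdiag' ht hqt) hinj ?_
    rw [hdiag' ht hqt, ← hdiag]
    exact mul_pos hk (pos_of_mul_pos_right (hQi ▸ hs) hsq.le)
  have hexcl (hD : Dominant f i) (hS : Subdominant f i) : False :=
    (hS Q hQ0 hQz).not_outsideConic (hD Q hQ0 hQz)
  refine ⟨hne, ⟨fun hD => ?_, hdom⟩, ⟨fun hS => ?_, hsub⟩⟩
  · by_contra hs
    exact hexcl hD (hsub (lt_of_le_of_ne (not_lt.1 hs) hne.symm))
  · by_contra hs
    exact hexcl (hdom (lt_of_le_of_ne (not_lt.1 hs) hne)) hS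

end Configuration

/-- If every edge of a hexagon has all other vertices on its positive side, then all triples of
vertices in cyclic order are positively oriented. -/
lemma bracket_pos_of_edges {v : Fin 6 → Fin 3 → ℝ}
    (h : ∀ i j, j ≠ i → j ≠ i + 1 → 0 < bracket (v i) (v (i + 1)) (v j)) {i j k : Fin 6}
    (hc : i < j ∧ j < k ∨ j < k ∧ k < i ∨ k < i ∧ i < j) :
    0 < bracket (v i) (v j) (v k) := by
  have hcases : ∀ i j k : Fin 6, (i < j ∧ j < k ∨ j < k ∧ k < i ∨ k < i ∧ i < j) →
      i ≠ j ∧ j ≠ k ∧ i ≠ k ∧ (j = i + 1 ∨ k = j + 1 ∨ i = k + 1 ∨ j = i + 2 ∧ k = i + 4) := by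
    decide
  obtain ⟨hij, hjk, hik, h1 | h1 | h1 | ⟨h1, h2⟩⟩ := hcases i j k hc
  · subst h1; exact h i k hik.symm hjk.symm
  · subst h1; rw [← bracket_rotate]; exact h j i hij hik
  · subst h1; rw [← bracket_rotate, ← bracket_rotate]; exact h k j hjk hij.symm
  · subst h1 h2
    have hp := bracket_plucker (v i) (v (i + 1)) (v (i + 2)) (v (i + 3)) (v (i + 4))
    have e2 : (i + 1) + 1 = i + 2 := by clear * - i; revert i; decide
    have e3 : (i + 2) + 1 = i + 3 := by clear * - i; revert i; decide
    have e4 : (i + 3) + 1 = i + 4 := by clear * - i; revert i; decide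
    have p1 := h i (i + 2) (by clear * - i; revert i; decide) (by clear * - i; revert i; decide)
    have p2 := h (i + 3) i (by clear * - i; revert i; decide) (by clear * - i; revert i; decide)
    have p3 := h i (i + 4) (by clear * - i; revert i; decide) (by clear * - i; revert i; decide)
    have p4 := h (i + 2) i (by clear * - i; revert i; decide) (by clear * - i; revert i; decide)
    have p5 := h i (i + 3) (by clear * - i; revert i; decide) (by clear * - i; revert i; decide)
    rw [e4, bracket_rotate] at p2
    rw [e3, bracket_rotate] at p4
    exact pos_of_mul_pos_right (hp ▸ add_pos (mul_pos p1 p2) (mul_pos p3 p4)) p5.le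

lemma fin_six_cyclic_induction {P : Fin 6 → Prop} (h0 : P 0) (hs : ∀ i, P i → P (i + 1))
    (i : Fin 6) : P i := by
  have h1 := hs 0 h0
  have h2 := hs 1 h1
  have h3 := hs 2 h2
  have h4 := hs 3 h3
  have h5 := hs 4 h4
  fin_cases i
  exacts [h0, h1, h2, h3, h4, h5]

/-- If each edge of a hexagon has all other vertices on one side, then after a common rescaling
this side is the positive one. -/
lemma exists_smul_bracket_pos {u : Fin 6 → Fin 3 → ℝ}
    (h : ∀ i j k, j ≠ i → j ≠ i + 1 → k ≠ i → k ≠ i + 1 →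
      0 < bracket (u i) (u (i + 1)) (u j) * bracket (u i) (u (i + 1)) (u k)) :
    ∃ δ : ℝ, δ ≠ 0 ∧ ∀ i j, j ≠ i → j ≠ i + 1 →
      0 < bracket (δ • u i) (δ • u (i + 1)) (δ • u j) := by
  obtain ⟨t, ht⟩ : ∃ t : Fin 6 → ℝ, ∀ i, t i = bracket (u i) (u (i + 1)) (u (i + 2)) :=
    ⟨_, fun _ => rfl⟩
  have hsucc (i : Fin 6) : 0 < t i * t (i + 1) := by
    have e2 : i + 1 + 1 = i + 2 := by clear * - i; revert i; decide
    have h1 := h (i + 1) i (i + 1 + 2) (by clear * - i; revert i; decide)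
      (by clear * - i; revert i; decide) (by clear * - i; revert i; decide)
      (by clear * - i; revert i; decide)
    rw [ht, ht, e2]
    rwa [e2, bracket_rotate (u i)] at h1
  have hsq (i : Fin 6) : 0 < t i * t i :=
    mul_self_pos.2 (left_ne_zero_of_mul (hsucc i).ne')
  have hall : ∀ i, 0 < t 0 * t i := by
    refine fin_six_cyclic_induction (hsq 0) fun i hi => ?_
    refine pos_of_mul_pos_right (a := t i * t i) ?_ (hsq i).le
    linarith [mul_pos hi (hsucc i)]
  refine ⟨t 0, left_ne_zero_of_mul (hsq 0).ne', fun i j hj hj' => ?_⟩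
  have h1 := h i (i + 2) j (by clear * - i; revert i; decide) (by clear * - i; revert i; decide)
    hj hj'
  rw [← ht] at h1
  have h2 : 0 < t 0 * bracket (u i) (u (i + 1)) (u j) := by
    refine pos_of_mul_pos_right (a := t i * t i) ?_ (hsq i).le
    linarith [mul_pos (hall i) h1]
  rw [bracket_smul]
  linarith [mul_pos (hsq 0) h2]

/-- The points of a consecutively labelled convex hexagon have representatives all of whose
cyclically ordered triples are positively oriented. -/
lemma exists_positive_representatives {f : Fin 6 → RP2} (hf : SimpleCfg f)
    (hconv : ConsecConvexPos f) :
    ∃ (r : Fin 6 → ℝ) (v : Fin 6 → Fin 3 → ℝ), (∀ j, r j ≠ 0) ∧ (∀ j, v j = r j • (f j).rep) ∧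
      ∀ i j k : Fin 6, (i < j ∧ j < k ∨ j < k ∧ k < i ∨ k < i ∧ i < j) →
        0 < bracket (v i) (v j) (v k) := by
  obtain ⟨φ, ⟨-, hφ, -⟩, hedge⟩ := hconv
  obtain ⟨u, hu⟩ : ∃ u : Fin 6 → Fin 3 → ℝ, ∀ i, u i = chart φ (f i) := ⟨_, fun _ => rfl⟩
  simp only [← hu] at hedge
  have hφu (i : Fin 6) : φ (u i) = 1 := by
    simp [hu, chart, hφ i]
  have hne (i j k : Fin 6) (hij : i ≠ j) (hik : i ≠ k) (hjk : j ≠ k) :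
      bracket (u i) (u j) (u k) ≠ 0 := by
    simp only [hu, chart, bracket_smul]
    have h := hf.2 i j k hij hik hjk
    rw [Collin, not_not] at h
    exact mul_ne_zero (by simp [hφ]) (bracket_ne_zero h)
  obtain ⟨δ, hδ, hpos⟩ := exists_smul_bracket_pos (u := u) fun i j k hj hj' hk hk' => by
    obtain ⟨ψ, hψ, hlt⟩ := hedge i
    have hg (x : Fin 6) : (ψ (u i) • φ - ψ) (u x) = ψ (u i) - ψ (u x) := by simp [hφu]
    have h1 := bracket_mul_apply (ψ (u i) • φ - ψ) (a := u i) (b := u (i + 1))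
      (by rw [hg, sub_self]) (by rw [hg]; exact sub_eq_zero.2 hψ) (u j) (u k)
    rw [hg, hg] at h1
    have pj : 0 < ψ (u i) - ψ (u j) := sub_pos.2 (hlt j hj hj')
    have pk : 0 < ψ (u i) - ψ (u k) := sub_pos.2 (hlt k hk hk')
    have hb := hne i (i + 1) j (by clear * - i; revert i; decide) hj.symm hj'.symm
    refine pos_of_mul_pos_left (b := ψ (u i) - ψ (u j)) ?_ pj.le
    have : bracket (u i) (u (i + 1)) (u j) * bracket (u i) (u (i + 1)) (u k) *
        (ψ (u i) - ψ (u j)) = (bracket (u i) (u (i + 1)) (u j)) ^ 2 * (ψ (u i) - ψ (u k)) := by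
      linear_combination -(bracket (u i) (u (i + 1)) (u j)) * h1
    rw [this]; positivity
  exact ⟨fun i => δ * (φ (f i).rep)⁻¹, fun i => δ • u i, fun j => by simp [hδ, hφ],
    fun j => by simp [hu, chart, smul_smul],
    fun i j k => bracket_pos_of_edges (v := fun i => δ • u i) hpos⟩

/-- In a convex hexagon, dominance and subdominance alternate in both directions. -/
lemma dominance_alternates {f : Fin 6 → RP2} (hf : TypicalCfg f) (hconv : ConsecConvexPos f)
    (i : Fin 6) : (Dominant f i ↔ Subdominant f (i + 1)) ∧
      (Dominant f (i + 1) ↔ Subdominant f i) ∧ (Subdominant f i ↔ ¬ Dominant f i) := by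
  obtain ⟨r, v, hr, hv, hpos⟩ := exists_positive_representatives hf.1 hconv
  have hcc : ¬ Coconic (Set.range f) := by simpa using hf.2 id Function.injective_id
  have pent (e : Fin 6) (he : e = i ∨ e = i + 1) :
      ConvexPentagon (v (i + 2)) (v (i + 3)) (v (i + 4)) (v (i + 5)) (v e) := by
    constructor <;> apply hpos <;> clear * - he <;> revert i e <;> decide
  have h0 := dominance_iff_conicForm (i := i) hr hv (by clear * - i; revert i; decide)
    (pent (i + 1) (Or.inr rfl)) hcc
  have h1 := dominance_iff_conicForm (i := i + 1) hr hv (by clear * - i; revert i; decide)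
    (pent i (Or.inl rfl)) hcc
  rw [conicForm_swap (pent (i + 1) (Or.inr rfl)).abc.ne', neg_lt_zero, neg_pos] at h1
  refine ⟨h0.2.1.trans h1.2.2.symm, h1.2.1.trans h0.2.2.symm, ?_⟩
  rw [h0.2.1, h0.2.2, not_lt]
  exact ⟨le_of_lt, fun h => lt_of_le_of_ne h h0.1.symm⟩

/-- A predicate alternating along a cycle of length six holds at exactly three places. -/
lemma card_alternating {D : Fin 6 → Prop} (h : ∀ i, D (i + 1) ↔ ¬ D i) :
    Nat.card {i // D i} = 3 ∧ Nat.card {i // ¬ D i} = 3 := by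
  classical
  obtain ⟨p, hD⟩ : ∃ p : Prop, ∀ i, D i ↔ (p ↔ i.val % 2 = 0) := by
    refine ⟨D 0, ?_⟩
    have h1 := h 0
    have h2 := h 1
    have h3 := h 2
    have h4 := h 3
    have h5 := h 4
    simp only [zero_add, Fin.reduceAdd] at h1 h2 h3 h4 h5
    intro i
    fin_cases i <;> simp [h1, h2, h3, h4, h5]
  rw [Nat.card_eq_fintype_card, Nat.card_eq_fintype_card, Fintype.card_subtype,
    Fintype.card_subtype]
  simp only [hD]
  by_cases hp : p <;> simp only [hp, true_iff, false_iff, not_not] <;> decide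

/-- In a hexagonal typical 6-configuration with consecutive cyclic labeling, dominant and
subdominant points alternate along the cyclic order; in particular there are exactly three
dominant and exactly three subdominant points. -/
theorem hexagonal_alternating_dominance (f : Fin 6 → RP2)
    (hf : TypicalCfg f) (hconv : ConsecConvexPos f) :
    (∀ i : Fin 6, Dominant f i ↔ Subdominant f (i + 1)) ∧
    Nat.card {i : Fin 6 // Dominant f i} = 3 ∧
    Nat.card {i : Fin 6 // Subdominant f i} = 3 := by
  have halt := dominance_alternates hf hconv
  refine ⟨fun i => (halt i).1, ?_⟩
  have hsub (i : Fin 6) : Subdominant f i ↔ ¬ Dominant f i := (halt i).2.2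
  have hdom (i : Fin 6) : Dominant f (i + 1) ↔ ¬ Dominant f i := (halt i).2.1.trans (hsub i)
  simp only [hsub]
  exact card_alternating hdom

end
end
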